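/- Let (M,Q) be a two-dimensional random vector with M>0 almost surely and P(M≠1)>0, and suppose there exists β>0 such that E[M^β]=1, E[M^β (ln M)⁺]<∞ and E[|Q|^β]<∞. Let Y_∞ be a random variable independent of (M,Q) whose law equals the law of Q+M·Y_∞, and set Ḡ(u) := P(Y_∞>u). Then: (1) limsup_{u→∞} u^β Ḡ(u) < ∞; (2) if Y_∞ is unbounded from above then liminf_{u→∞} u^β Ḡ(u) > 0; (3) if moreover the law of ln M is non-arithmetic and Y_∞ is unbounded from above, then Ḡ(u) ∼ C₊ u^{−β} as u→∞ for some constant C₊>0. -/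

import Mathlib

open MeasureTheory ProbabilityTheory Filter Real

section HarmonicAtInfinity

variable {P : Measure ℝ} [IsProbabilityMeasure P]

/-- If a bounded Lipschitz function `φ` is asymptotically harmonic for the steps `P` and converges
along `F` to its upper limit, then so do its translates by points of the support of `P`. -/
theorem tendsto_comp_sub_of_mem_support {φ : ℝ → ℝ} {B K c : ℝ} (hB : ∀ t, |φ t| ≤ B)
    (hK : ∀ s t, |φ s - φ t| ≤ K * |s - t|) (hφm : Continuous φ)
    (hP : Tendsto (fun t => ∫ y, (φ t - φ (t - y)) ∂P) atTop (nhds 0))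
    (hc : ∀ ε > 0, ∀ᶠ t in atTop, φ t ≤ c + ε) {F : Filter ℝ} (hF : F ≤ atTop)
    (hφ : Tendsto φ F (nhds c)) {x : ℝ} (hx : x ∈ P.support) :
    Tendsto (fun t => φ (t - x)) F (nhds c) := by
  have hinteg : ∀ t, Integrable (fun y => φ (t - y)) P := fun t =>
    Integrable.of_bound (by fun_prop) B (ae_of_all _ fun y => hB _)
  have hpos : Tendsto (fun t => ∫ y, max (φ (t - y) - c) 0 ∂P) atTop (nhds 0) := by
    rw [show nhds (0 : ℝ) = nhds (∫ _y : ℝ, (0 : ℝ) ∂P) by simp]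
    refine tendsto_integral_filter_of_dominated_convergence (fun _ => B + |c|) ?_ ?_
      (integrable_const _) ?_
    · exact Eventually.of_forall fun t => by fun_prop
    · refine Eventually.of_forall fun t => ae_of_all _ fun y => ?_
      rw [Real.norm_eq_abs, abs_of_nonneg (le_max_right _ _)]
      have h1 := hB (t - y)
      have h2 := abs_nonneg (φ (t - y))
      refine max_le ?_ (by linarith [abs_nonneg c])
      linarith [le_abs_self (φ (t - y)), neg_abs_le c]
    · refine ae_of_all _ fun y => ?_
      rw [Metric.tendsto_nhds]
      intro ε hε
      have h := (tendsto_atTop_add_const_right atTop (-y) tendsto_id).eventually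
        (hc (ε / 2) (by positivity))
      filter_upwards [h] with t ht
      simp only [id, ← sub_eq_add_neg] at ht
      rw [Real.dist_eq, sub_zero, abs_of_nonneg (le_max_right _ _)]
      exact max_lt (by linarith) hε
  have habs : Tendsto (fun t => ∫ y, |c - φ (t - y)| ∂P) F (nhds 0) := by
    have h1 : ∀ t, ∫ y, |c - φ (t - y)| ∂P
        = (c - φ t) + ∫ y, (φ t - φ (t - y)) ∂P + 2 * ∫ y, max (φ (t - y) - c) 0 ∂P := by
      intro t
      have hi1 : Integrable (fun y => φ t - φ (t - y)) P := (integrable_const _).sub (hinteg t)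
      have hi2 : Integrable (fun y => max (φ (t - y) - c) 0) P :=
        ((hinteg t).sub (integrable_const c)).pos_part
      have h2 : ∫ _y, (c - φ t) ∂P = c - φ t := by simp
      rw [← h2, ← integral_const_mul, ← integral_add (integrable_const _) hi1, ← integral_add
        (f := fun y => c - φ t + (φ t - φ (t - y))) ((integrable_const _).add hi1)
        (hi2.const_mul 2)]
      congr 1 with y
      rcases le_total (φ (t - y) - c) 0 with h | h
      · rw [max_eq_right h, abs_of_nonneg (by linarith)]; ring
      · rw [max_eq_left h, abs_of_nonpos (by linarith)]; ring
    simp_rw [h1]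
    have h2 : Tendsto (fun t => c - φ t) F (nhds 0) := by
      simpa using (tendsto_const_nhds (x := c)).sub hφ
    simpa using (h2.add (hP.mono_left hF)).add ((hpos.mono_left hF).const_mul 2)
  have hK0 : 0 ≤ K := by
    have := (abs_nonneg _).trans (hK 1 0)
    simpa using this
  rw [Metric.tendsto_nhds]
  intro ε hε
  set δ := ε / (2 * (K + 1)) with hδ
  have hδ0 : 0 < δ := by positivity
  have hKδ : K * δ ≤ ε / 2 := by
    rw [hδ]
    have : K * (ε / (2 * (K + 1))) = (ε / 2) * (K / (K + 1)) := by field_simp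
    rw [this]
    have : K / (K + 1) ≤ 1 := by rw [div_le_one (by linarith)]; linarith
    nlinarith
  have hp : 0 < P.real (Metric.ball x δ) :=
    ENNReal.toReal_pos ((Measure.mem_support_iff_forall x).1 hx _
      (Metric.ball_mem_nhds x hδ0)).ne' (measure_ne_top _ _)
  have hev := habs.eventually (gt_mem_nhds
    (show 0 < P.real (Metric.ball x δ) * (ε / 2) by positivity))
  filter_upwards [hev] with t ht
  have h1 : P.real (Metric.ball x δ) * (|c - φ (t - x)| - K * δ) ≤ ∫ y, |c - φ (t - y)| ∂P := by
    have hi : Integrable (fun y => |c - φ (t - y)|) P := ((integrable_const c).sub (hinteg t)).abs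
    calc P.real (Metric.ball x δ) * (|c - φ (t - x)| - K * δ)
        = ∫ y in Metric.ball x δ, (|c - φ (t - x)| - K * δ) ∂P := by simp
      _ ≤ ∫ y in Metric.ball x δ, |c - φ (t - y)| ∂P := by
          refine setIntegral_mono_on (integrable_const _).integrableOn hi.integrableOn
            measurableSet_ball fun y hy => ?_
          have h2 := hK (t - y) (t - x)
          have h3 : |t - y - (t - x)| ≤ δ := by
            rw [show t - y - (t - x) = -(y - x) by ring, abs_neg]
            exact (Metric.mem_ball.1 hy).le
          have h4 : K * |t - y - (t - x)| ≤ K * δ := by gcongr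
          have h5 := abs_sub_abs_le_abs_sub (c - φ (t - x)) (c - φ (t - y))
          rw [show c - φ (t - x) - (c - φ (t - y)) = φ (t - y) - φ (t - x) by ring] at h5
          linarith
      _ ≤ ∫ y, |c - φ (t - y)| ∂P :=
          setIntegral_le_integral hi (ae_of_all _ fun y => abs_nonneg _)
  have h2 : |c - φ (t - x)| - K * δ < ε / 2 := lt_of_mul_lt_mul_left (h1.trans_lt ht) hp.le
  rw [Real.dist_eq, abs_sub_comm]
  linarith

/-- Upper half of the asymptotic Choquet-Deny lemma. -/
theorem eventually_sub_comp_sub_le {f : ℝ → ℝ} {B K : ℝ} (hB : ∀ t, |f t| ≤ B)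
    (hK : ∀ s t, |f s - f t| ≤ K * |s - t|) (hfm : Continuous f)
    (hP : Tendsto (fun t => ∫ y, (f t - f (t - y)) ∂P) atTop (nhds 0))
    {x : ℝ} (hx : x ∈ P.support) {ε : ℝ} (hε : 0 < ε) :
    ∀ᶠ t in atTop, f t - f (t - x) ≤ ε := by
  set φ : ℝ → ℝ := fun t => f t - f (t - x) with hφ
  have hφB : ∀ t, |φ t| ≤ 2 * B := fun t => by
    have := abs_sub (f t) (f (t - x)); linarith [hB t, hB (t - x)]
  have hφK : ∀ s t, |φ s - φ t| ≤ 2 * K * |s - t| := fun s t => by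
    have h1 := hK s t
    have h2 := hK (s - x) (t - x)
    rw [show s - x - (t - x) = s - t by ring] at h2
    have h3 := abs_sub (f s - f t) (f (s - x) - f (t - x))
    rw [show φ s - φ t = f s - f t - (f (s - x) - f (t - x)) by simp only [hφ]; ring]
    linarith
  have hinteg : ∀ t, Integrable (fun y => f (t - y)) P := fun t =>
    Integrable.of_bound (by fun_prop) B (ae_of_all _ fun y => hB _)
  have hφP : Tendsto (fun t => ∫ y, (φ t - φ (t - y)) ∂P) atTop (nhds 0) := by
    have h1 := hP.comp (tendsto_atTop_add_const_right atTop (-x) tendsto_id)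
    have h2 := hP.sub h1
    rw [sub_zero] at h2
    refine h2.congr fun t => ?_
    simp only [Function.comp, id, ← sub_eq_add_neg]
    rw [← integral_sub]
    · congr 1 with y
      simp only [hφ]
      rw [show t - x - y = t - y - x by ring]; ring
    · exact (integrable_const _).sub (hinteg t)
    · exact (integrable_const _).sub (hinteg _)
  have hbdd : IsBoundedUnder (· ≤ ·) atTop φ :=
    isBoundedUnder_of ⟨2 * B, fun t => (le_abs_self _).trans (hφB t)⟩
  have hcobdd : IsCoboundedUnder (· ≤ ·) atTop φ :=
    IsBoundedUnder.isCoboundedUnder_le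
      (isBoundedUnder_of ⟨-(2 * B), fun t => (neg_le_neg (hφB t)).trans (neg_abs_le _)⟩)
  set c := limsup φ atTop with hcdef
  have hup : ∀ ε > 0, ∀ᶠ t in atTop, φ t ≤ c + ε := fun ε hε =>
    (eventually_lt_of_limsup_lt (show limsup φ atTop < c + ε by linarith) hbdd).mono
      fun t ht => ht.le
  have hcl : MapClusterPt c atTop φ := by
    rw [mapClusterPt_iff_frequently]
    intro s hs
    obtain ⟨η, hη, hsub⟩ := Metric.mem_nhds_iff.1 hs
    have h1 := frequently_lt_of_lt_limsup hcobdd (show c - η < limsup φ atTop by linarith)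
    refine (h1.and_eventually (hup (η / 2) (by positivity))).mono fun t ht => hsub ?_
    rw [Metric.mem_ball, Real.dist_eq, abs_lt]
    constructor <;> linarith [ht.1, ht.2]
  set F := atTop ⊓ comap φ (nhds c) with hF
  have hne : F.NeBot := by
    rw [hF, inf_comm]
    exact (mapClusterPt_iff_frequently.1 hcl |> fun h => by
      rw [← mapClusterPt_iff_frequently] at h
      exact neBot_inf_comap_iff_map'.2 h)
  have hF1 : F ≤ atTop := inf_le_left
  have hF2 : Tendsto φ F (nhds c) := tendsto_comap.mono_left inf_le_right
  have hall : ∀ k : ℕ, Tendsto (fun t => φ (t - k * x)) F (nhds c) := by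
    intro k
    induction k with
    | zero => simpa using hF2
    | succ k ih =>
      have h1 : map (fun t => t - k * x) F ≤ atTop := by
        have : Tendsto (fun t : ℝ => t - k * x) atTop atTop := by
          simpa [sub_eq_add_neg] using
            tendsto_atTop_add_const_right atTop (-(k * x)) (tendsto_id (α := ℝ))
        exact (map_mono hF1).trans this
      have h2 := tendsto_comp_sub_of_mem_support hφB hφK (by fun_prop) hφP hup h1
        (by rwa [tendsto_map'_iff]) hx
      rw [tendsto_map'_iff] at h2
      refine h2.congr fun t => ?_
      simp only [Function.comp]
      congr 1
      push_cast; ring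
  have hsum : ∀ n : ℕ, (n : ℝ) * c ≤ 2 * B := by
    intro n
    have h1 : Tendsto (fun t => ∑ k ∈ Finset.range n, φ (t - k * x)) F (nhds (n * c)) := by
      have := tendsto_finsetSum (Finset.range n) (fun k _ => hall k)
      simpa using this
    refine le_of_tendsto h1 (Eventually.of_forall fun t => ?_)
    have h2 : ∑ k ∈ Finset.range n, φ (t - k * x) = f t - f (t - n * x) := by
      have h3 := Finset.sum_range_sub' (fun k : ℕ => f (t - k * x)) n
      simp only [Nat.cast_zero, zero_mul, sub_zero] at h3
      rw [← h3]
      refine Finset.sum_congr rfl fun k _ => ?_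
      simp only [hφ]
      congr 2
      push_cast; ring
    rw [h2]
    have := abs_sub (f t) (f (t - n * x))
    linarith [hB t, hB (t - n * x), le_abs_self (f t - f (t - n * x))]
  have hc0 : c ≤ 0 := by
    by_contra! hcpos
    obtain ⟨n, hn⟩ := exists_nat_gt (2 * B / c)
    rw [div_lt_iff₀ hcpos] at hn
    linarith [hsum n]
  filter_upwards [hup ε hε] with t ht
  simp only [hφ] at ht
  linarith

/-- The asymptotic Choquet-Deny lemma: a bounded Lipschitz function that is asymptotically harmonic
is asymptotically invariant under translation by points of the support of the step law. -/
theorem tendsto_sub_comp_sub_of_mem_support {f : ℝ → ℝ} {B K : ℝ} (hB : ∀ t, |f t| ≤ B)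
    (hK : ∀ s t, |f s - f t| ≤ K * |s - t|) (hfm : Continuous f)
    (hP : Tendsto (fun t => ∫ y, (f t - f (t - y)) ∂P) atTop (nhds 0))
    {x : ℝ} (hx : x ∈ P.support) :
    Tendsto (fun t => f t - f (t - x)) atTop (nhds 0) := by
  rw [Metric.tendsto_nhds]
  intro ε hε
  have h1 := eventually_sub_comp_sub_le hB hK hfm hP hx (half_pos hε)
  have h2 := eventually_sub_comp_sub_le (P := P) (f := fun t => -f t) (B := B) (K := K)
    (by simpa using hB) (fun s t => by
      rw [show -f s - -f t = -(f s - f t) by ring, abs_neg]; exact hK s t) (by fun_prop)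
    (by
      have := hP.neg
      rw [neg_zero] at this
      refine this.congr fun t => ?_
      rw [← integral_neg]
      congr 1 with y
      ring) hx (half_pos hε)
  filter_upwards [h1, h2] with t h1 h2
  rw [Real.dist_eq, sub_zero, abs_lt]
  constructor <;> linarith

/-- The asymptotic Choquet-Deny lemma for a non-arithmetic step law. -/
theorem tendsto_sub_comp_sub_of_not_arithmetic {f : ℝ → ℝ} {B K : ℝ} (hB : ∀ t, |f t| ≤ B)
    (hK : ∀ s t, |f s - f t| ≤ K * |s - t|) (hfm : Continuous f)
    (hP : Tendsto (fun t => ∫ y, (f t - f (t - y)) ∂P) atTop (nhds 0))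
    (hna : ¬ ∃ d : ℝ, 0 < d ∧ ∀ᵐ y ∂P, ∃ k : ℤ, y = k * d) (x : ℝ) :
    Tendsto (fun t => f t - f (t - x)) atTop (nhds 0) := by
  have hshift : ∀ a : ℝ, Tendsto (fun t : ℝ => t - a) atTop atTop := fun a => by
    simpa [sub_eq_add_neg] using tendsto_atTop_add_const_right atTop (-a) (tendsto_id (α := ℝ))
  let S : AddSubgroup ℝ :=
    { carrier := {x | Tendsto (fun t => f t - f (t - x)) atTop (nhds 0)}
      zero_mem' := by simp
      add_mem' := by
        intro a b ha hb
        simp only [Set.mem_ofPred_eq] at ha hb ⊢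
        have := ha.add (hb.comp (hshift a))
        rw [add_zero] at this
        refine this.congr fun t => ?_
        simp only [Function.comp]
        rw [show t - a - b = t - (a + b) by ring]; ring
      neg_mem' := by
        intro a ha
        simp only [Set.mem_ofPred_eq] at ha ⊢
        have := (ha.comp (hshift (-a))).neg
        rw [neg_zero] at this
        refine this.congr fun t => ?_
        simp only [Function.comp]
        rw [show t - -a - a = t by ring]; ring }
  have hSsupp : P.support ⊆ S := fun y hy =>
    tendsto_sub_comp_sub_of_mem_support hB hK hfm hP hy
  have hdense : Dense (S : Set ℝ) := by
    rcases S.dense_or_cyclic with h | ⟨a, ha⟩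
    · exact h
    · exfalso
      rw [← AddSubgroup.zmultiples_eq_closure] at ha
      have hae : ∀ᵐ y ∂P, ∃ k : ℤ, y = k * a := by
        filter_upwards [P.support_mem_ae] with y hy
        have : y ∈ S := hSsupp hy
        rw [ha, AddSubgroup.mem_zmultiples_iff] at this
        obtain ⟨k, hk⟩ := this
        exact ⟨k, by rw [← hk]; simp⟩
      apply hna
      rcases lt_trichotomy a 0 with h0 | h0 | h0
      · refine ⟨-a, by linarith, hae.mono ?_⟩
        rintro y ⟨k, hk⟩
        exact ⟨-k, by rw [hk]; push_cast; ring⟩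
      · refine ⟨1, one_pos, hae.mono ?_⟩
        rintro y ⟨k, hk⟩
        exact ⟨0, by rw [hk, h0]; simp⟩
      · exact ⟨a, h0, hae⟩
  have hK0 : 0 ≤ K := by simpa using (abs_nonneg _).trans (hK 1 0)
  rw [Metric.tendsto_nhds]
  intro ε hε
  obtain ⟨y, hy, hyS⟩ := Metric.dense_iff.1 hdense x (ε / (2 * (K + 1))) (by positivity)
  have hyt : Tendsto (fun t => f t - f (t - y)) atTop (nhds 0) := hyS
  filter_upwards [Metric.tendsto_nhds.1 hyt (ε / 2) (by positivity)] with t ht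
  rw [Real.dist_eq, sub_zero] at ht ⊢
  have h1 := hK (t - y) (t - x)
  rw [show t - y - (t - x) = -(y - x) by ring, abs_neg] at h1
  have h2 : |y - x| < ε / (2 * (K + 1)) := hy
  have h3 : K * |y - x| ≤ ε / 2 := by
    have : (K + 1) * (ε / (2 * (K + 1))) = ε / 2 := by field_simp
    nlinarith [abs_nonneg (y - x)]
  have h4 := abs_add_le (f t - f (t - y)) (f (t - y) - f (t - x))
  rw [show f t - f (t - y) + (f (t - y) - f (t - x)) = f t - f (t - x) by ring] at h4
  linarith

/-- Key renewal theorem in potential form: if `a` has at most linear increments and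
`∫ (a t - a (t - y)) ∂P` converges to `H`, then `a` grows asymptotically linearly with slope
`H / ∫ y ∂P`, provided `P` is non-arithmetic with positive mean. -/
theorem tendsto_increment_of_not_arithmetic {a : ℝ → ℝ} {K H : ℝ}
    (hK : ∀ s t, |a s - a t| ≤ K * |s - t|)
    (hP : Tendsto (fun t => ∫ y, (a t - a (t - y)) ∂P) atTop (nhds H))
    (hinteg : Integrable (fun y => y) P) (hmean : 0 < ∫ y, y ∂P)
    (hna : ¬ ∃ d : ℝ, 0 < d ∧ ∀ᵐ y ∂P, ∃ k : ℤ, y = k * d) (x : ℝ) :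
    Tendsto (fun t => a t - a (t - x)) atTop (nhds (x * (H / ∫ y, y ∂P))) := by
  have hK0 : 0 ≤ K := by simpa using (abs_nonneg _).trans (hK 1 0)
  have hacont : Continuous a := by
    refine (LipschitzWith.of_dist_le_mul (K := K.toNNReal) fun s t => ?_).continuous
    rw [Real.dist_eq, Real.dist_eq, Real.coe_toNNReal _ hK0]
    exact hK s t
  have hshift : ∀ b : ℝ, Tendsto (fun t : ℝ => t - b) atTop atTop := fun b => by
    simpa [sub_eq_add_neg] using tendsto_atTop_add_const_right atTop (-b) (tendsto_id (α := ℝ))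
  have hinta : ∀ t, Integrable (fun y => a t - a (t - y)) P := fun t => by
    refine (hinteg.norm.const_mul K).mono' (by fun_prop) (ae_of_all _ fun y => ?_)
    have := hK t (t - y)
    rwa [sub_sub_cancel] at this
  have hsecond : ∀ h y : ℝ, Tendsto
      (fun t => (a (t + h) - a t) - (a (t - y + h) - a (t - y))) atTop (nhds 0) := by
    intro h y
    refine tendsto_sub_comp_sub_of_not_arithmetic (P := P) (f := fun t => a (t + h) - a t)
      (B := K * |h|) (K := 2 * K) ?_ ?_ (by fun_prop) ?_ hna y
    · intro t
      have := hK (t + h) t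
      rwa [add_sub_cancel_left] at this
    · intro s t
      have h1 := hK s t
      have h2 := hK (s + h) (t + h)
      rw [add_sub_add_right_eq_sub] at h2
      have h3 := abs_sub (a (s + h) - a (t + h)) (a s - a t)
      rw [show a (s + h) - a s - (a (t + h) - a t) = a (s + h) - a (t + h) - (a s - a t) by ring]
      linarith
    · have h1 := (hP.comp (tendsto_atTop_add_const_right atTop h tendsto_id)).sub hP
      rw [sub_self] at h1
      refine h1.congr fun t => ?_
      simp only [Function.comp, id]
      rw [← integral_sub (hinta _) (hinta _)]
      congr 1 with y
      rw [show t + h - y = t - y + h by ring]; ring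
  set e : ℝ → ℝ → ℝ := fun t x => a t - a (t - x) - x * (a (t + 1) - a t) with he
  have heb : ∀ t x, |e t x| ≤ 2 * K * |x| := by
    intro t x
    have h1 := hK t (t - x)
    have h2 := hK (t + 1) t
    rw [sub_sub_cancel] at h1
    rw [add_sub_cancel_left, abs_one, mul_one] at h2
    have h3 := abs_sub (a t - a (t - x)) (x * (a (t + 1) - a t))
    rw [abs_mul] at h3
    have h4 : |x| * |a (t + 1) - a t| ≤ |x| * K := by gcongr
    simp only [he]
    linarith
  let S : AddSubgroup ℝ :=
    { carrier := {x | Tendsto (fun t => e t x) atTop (nhds 0)}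
      zero_mem' := by simp [he]
      add_mem' := by
        intro b c hb hc
        simp only [Set.mem_ofPred_eq] at hb hc ⊢
        have := (hb.add hc).add (hsecond (-c) b)
        rw [add_zero, add_zero] at this
        refine this.congr fun t => ?_
        simp only [he]
        rw [show t + -c = t - c by ring, show t - b + -c = t - (b + c) by ring]; ring
      neg_mem' := by
        intro b hb
        simp only [Set.mem_ofPred_eq] at hb ⊢
        have := hb.neg.sub (hsecond b b)
        rw [neg_zero, sub_zero] at this
        refine this.congr fun t => ?_
        simp only [he]
        rw [show t - -b = t + b by ring, show t - b + b = t by ring]; ring }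
  have hnat : ∀ (n : ℕ) (y : ℝ), Tendsto (fun t => n * e t y - e t (n * y)) atTop (nhds 0) := by
    intro n y
    induction n with
    | zero => simp [he]
    | succ n ih =>
      have := ih.sub (hsecond (-y) (n * y))
      rw [sub_zero] at this
      refine this.congr fun t => ?_
      simp only [he]
      push_cast
      rw [show t + -y = t - y by ring, show t - n * y + -y = t - (n + 1) * y by ring]; ring
  have hone : Tendsto (fun t => e t 1) atTop (nhds 0) := by
    have := hsecond 1 1
    have := this.neg
    rw [neg_zero] at this
    refine this.congr fun t => ?_
    simp only [he]
    rw [show t - 1 + 1 = t by ring]; ring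
  have hinv : ∀ n : ℕ, (1 / (n + 1) : ℝ) ∈ S := by
    intro n
    have h1 := hnat (n + 1) (1 / (n + 1))
    have h2 : ((n + 1 : ℕ) : ℝ) * (1 / (n + 1)) = 1 := by push_cast; field_simp
    rw [h2] at h1
    have h3 := (h1.add hone).const_mul (1 / (n + 1 : ℝ))
    rw [add_zero, mul_zero] at h3
    refine h3.congr fun t => ?_
    push_cast
    field_simp
    ring
  have hdense : Dense (S : Set ℝ) := by
    refine AddSubgroup.dense_of_not_isolated_zero S fun ε hε => ?_
    obtain ⟨n, hn⟩ := exists_nat_one_div_lt hε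
    exact ⟨_, hinv n, by positivity, hn⟩
  have hall : ∀ x, Tendsto (fun t => e t x) atTop (nhds 0) := by
    intro x
    rw [Metric.tendsto_nhds]
    intro ε hε
    obtain ⟨y, hy, hyS⟩ := Metric.dense_iff.1 hdense x (ε / (4 * (K + 1))) (by positivity)
    have hyt : Tendsto (fun t => e t y) atTop (nhds 0) := hyS
    filter_upwards [Metric.tendsto_nhds.1 hyt (ε / 2) (by positivity)] with t ht
    rw [Real.dist_eq, sub_zero] at ht ⊢
    have h1 : |e t x - e t y| ≤ 2 * K * |y - x| := by
      have h2 := hK (t - y) (t - x)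
      rw [show t - y - (t - x) = -(y - x) by ring, abs_neg] at h2
      have h3 := hK (t + 1) t
      rw [add_sub_cancel_left, abs_one, mul_one] at h3
      have h4 := abs_add_le (a (t - y) - a (t - x)) ((y - x) * (a (t + 1) - a t))
      rw [abs_mul] at h4
      have h5 : |y - x| * |a (t + 1) - a t| ≤ |y - x| * K := by gcongr
      rw [show e t x - e t y = a (t - y) - a (t - x) + (y - x) * (a (t + 1) - a t) by
        simp only [he]; ring]
      linarith
    have h2 : |y - x| < ε / (4 * (K + 1)) := hy
    have h3 : 2 * K * |y - x| ≤ ε / 2 := by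
      have : (K + 1) * (ε / (4 * (K + 1))) = ε / 4 := by field_simp
      nlinarith [abs_nonneg (y - x)]
    have h4 := abs_add_le (e t x - e t y) (e t y)
    rw [sub_add_cancel] at h4
    linarith
  have hE : Tendsto (fun t => ∫ y, e t y ∂P) atTop (nhds 0) := by
    rw [show nhds (0 : ℝ) = nhds (∫ _y : ℝ, (0 : ℝ) ∂P) by simp]
    refine tendsto_integral_filter_of_dominated_convergence (fun y => 2 * K * |y|) ?_ ?_
      (hinteg.norm.const_mul _) ?_
    · exact Eventually.of_forall fun t => by simp only [he]; fun_prop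
    · exact Eventually.of_forall fun t => ae_of_all _ fun y => heb t y
    · exact ae_of_all _ fun y => hall y
  have hslope : Tendsto (fun t => a (t + 1) - a t) atTop (nhds (H / ∫ y, y ∂P)) := by
    have h1 := (hP.sub hE).div_const (∫ y, y ∂P)
    rw [sub_zero] at h1
    refine h1.congr fun t => ?_
    simp only [he]
    rw [integral_sub (hinta t) (hinteg.mul_const _), integral_mul_const]
    field_simp
    ring
  have h1 := (hall x).add (hslope.const_mul x)
  rw [zero_add] at h1
  refine h1.congr fun t => ?_
  simp only [he]
  ring

end HarmonicAtInfinity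

section PosPow

/-- The power `x ↦ (x⁺)^p` of the positive part. -/
noncomputable def posPow (p x : ℝ) : ℝ := max x 0 ^ p

theorem posPow_nonneg (p x : ℝ) : 0 ≤ posPow p x := rpow_nonneg (le_max_right _ _) p

theorem posPow_of_nonneg {x : ℝ} (hx : 0 ≤ x) (p : ℝ) : posPow p x = x ^ p := by
  rw [posPow, max_eq_left hx]

theorem posPow_of_nonpos {x p : ℝ} (hx : x ≤ 0) (hp : p ≠ 0) : posPow p x = 0 := by
  rw [posPow, max_eq_right hx, zero_rpow hp]

theorem posPow_mono {p : ℝ} (hp : 0 ≤ p) : Monotone (posPow p) := fun _ _ hxy =>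
  rpow_le_rpow (le_max_right _ _) (max_le_max_right _ hxy) hp

theorem posPow_mul {m : ℝ} (hm : 0 ≤ m) (p x : ℝ) : posPow p (m * x) = m ^ p * posPow p x := by
  rw [posPow, posPow, ← mul_rpow hm (le_max_right _ _), mul_max_of_nonneg _ _ hm, mul_zero]

@[fun_prop]
theorem measurable_posPow (p : ℝ) : Measurable (posPow p) := by
  unfold posPow; fun_prop

theorem lt_posPow_iff {p u x : ℝ} (hp : 0 < p) (hu : 0 ≤ u) : u ^ p < posPow p x ↔ u < x := by
  rw [posPow, rpow_lt_rpow_iff hu (le_max_right _ _) hp, lt_max_iff]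
  exact ⟨fun h => h.resolve_right (not_lt.2 hu), Or.inl⟩

theorem exists_abs_one_add_rpow_sub_one_le {p : ℝ} (hp : 0 < p) :
    ∃ C, 1 ≤ C ∧ ∀ s ∈ Set.Icc (-1 : ℝ) 1, |(1 + s) ^ p - 1| ≤ C * |s| := by
  refine ⟨p + 2 ^ p + 1, by have := rpow_pos_of_pos (zero_lt_two (α := ℝ)) p; linarith, ?_⟩
  rintro s ⟨hs1, hs2⟩
  have h2p := rpow_pos_of_pos (zero_lt_two (α := ℝ)) p
  rcases le_total 1 p with h1 | h1
  · have hb := one_add_mul_self_le_rpow_one_add hs1 h1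
    rcases le_total 0 s with h0 | h0
    · rw [abs_of_nonneg h0, abs_of_nonneg (by nlinarith)]
      have hc := (convexOn_rpow h1).2 (show (1 : ℝ) ∈ Set.Ici 0 by simp)
        (show (2 : ℝ) ∈ Set.Ici 0 by simp) (show 0 ≤ 1 - s by linarith) h0 (by ring)
      simp only [smul_eq_mul, one_rpow] at hc
      rw [show (1 - s) * 1 + s * 2 = 1 + s by ring] at hc
      nlinarith
    · have : (1 + s) ^ p ≤ 1 := rpow_le_one (by linarith) (by linarith) hp.le
      rw [abs_of_nonpos h0, abs_of_nonpos (by linarith)]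
      nlinarith
  · have hb := rpow_one_add_le_one_add_mul_self hs1 hp.le h1
    rcases le_total 0 s with h0 | h0
    · have : 1 ≤ (1 + s) ^ p := one_le_rpow (by linarith) hp.le
      rw [abs_of_nonneg h0, abs_of_nonneg (by linarith)]
      nlinarith
    · have h3 : (1 + s) ^ p ≤ 1 := rpow_le_one (by linarith) (by linarith) hp.le
      have h4 : 1 + s ≤ (1 + s) ^ p := by
        rcases eq_or_lt_of_le (show 0 ≤ 1 + s by linarith) with h | h
        · rw [← h]; exact rpow_nonneg le_rfl p
        · conv_lhs => rw [← rpow_one (1 + s)]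
          exact rpow_le_rpow_of_exponent_ge h (by linarith) h1
      rw [abs_of_nonpos h0, abs_of_nonpos (by linarith)]
      nlinarith

theorem exists_abs_posPow_add_sub_le {p ε : ℝ} (hε : 0 < ε) (hε1 : ε ≤ 1) (hεp : ε ≤ p) :
    ∃ C, 0 < C ∧ ∀ x q : ℝ,
      |posPow p (x + q) - posPow p x| ≤ C * (|q| ^ p + |q| ^ ε * posPow (p - ε) x) := by
  have hp : 0 < p := hε.trans_le hεp
  obtain ⟨C, hC1, hC⟩ := exists_abs_one_add_rpow_sub_one_le hp
  have h2p := rpow_pos_of_pos (zero_lt_two (α := ℝ)) p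
  refine ⟨C + 2 ^ p, by linarith, fun x q => ?_⟩
  simp only [posPow]
  set a := max x 0 with ha
  set b := max (x + q) 0 with hb
  have ha0 : 0 ≤ a := le_max_right _ _
  have hb0 : 0 ≤ b := le_max_right _ _
  have hab : |b - a| ≤ |q| := by
    have := abs_max_sub_max_le_max (x + q) 0 x 0
    simpa using this
  have hqp := rpow_nonneg (abs_nonneg q) p
  have hqe := mul_nonneg (rpow_nonneg (abs_nonneg q) ε) (rpow_nonneg ha0 (p - ε))
  rcases lt_or_ge |q| a with h | h
  · have ha1 : 0 < a := (abs_nonneg q).trans_lt h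
    have h1 : |b - a| / a ≤ 1 := by rw [div_le_one ha1]; linarith
    have hs : |(b - a) / a| = |b - a| / a := by rw [abs_div, abs_of_pos ha1]
    have h2 := hC ((b - a) / a) (by rw [Set.mem_Icc, ← abs_le, hs]; exact h1)
    rw [hs, show 1 + (b - a) / a = b / a by field_simp; ring, div_rpow hb0 ha0] at h2
    have hap : 0 < a ^ p := rpow_pos_of_pos ha1 p
    have h3 : |b ^ p - a ^ p| ≤ C * (a ^ p * (|b - a| / a)) := by
      have : b ^ p - a ^ p = a ^ p * (b ^ p / a ^ p - 1) := by field_simp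
      rw [this, abs_mul, abs_of_pos hap]
      nlinarith
    have h4 : a ^ p * (|b - a| / a) ≤ |q| ^ ε * a ^ (p - ε) := by
      have h5 : |b - a| / a ≤ (|q| / a) ^ ε := by
        have h6 : |q| / a ≤ 1 := by rw [div_le_one ha1]; exact h.le
        have h7 : |q| / a ≤ (|q| / a) ^ ε := by
          rcases eq_or_lt_of_le (div_nonneg (abs_nonneg q) ha0) with h8 | h8
          · rw [← h8]; exact rpow_nonneg le_rfl _
          · conv_lhs => rw [← rpow_one (|q| / a)]
            exact rpow_le_rpow_of_exponent_ge h8 h6 hε1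
        exact (by gcongr : |b - a| / a ≤ |q| / a).trans h7
      rw [div_rpow (abs_nonneg q) ha0] at h5
      calc a ^ p * (|b - a| / a) ≤ a ^ p * (|q| ^ ε / a ^ ε) := by gcongr
        _ = |q| ^ ε * a ^ (p - ε) := by rw [rpow_sub ha1]; ring
    calc |b ^ p - a ^ p| ≤ C * (|q| ^ ε * a ^ (p - ε)) := h3.trans (by gcongr)
      _ ≤ (C + 2 ^ p) * (|q| ^ p + |q| ^ ε * a ^ (p - ε)) := by gcongr <;> linarith
  · have hb2 : b ≤ 2 * |q| := by linarith [le_abs_self (b - a)]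
    have h1 : b ^ p ≤ 2 ^ p * |q| ^ p := by
      rw [← mul_rpow zero_le_two (abs_nonneg q)]
      exact rpow_le_rpow hb0 hb2 hp.le
    have h2 : a ^ p ≤ 2 ^ p * |q| ^ p := by
      rw [← mul_rpow zero_le_two (abs_nonneg q)]
      exact rpow_le_rpow ha0 (by linarith [abs_nonneg q]) hp.le
    have h3 : |b ^ p - a ^ p| ≤ 2 ^ p * |q| ^ p :=
      abs_sub_le_of_nonneg_of_le (rpow_nonneg hb0 p) h1 (rpow_nonneg ha0 p) h2
    calc |b ^ p - a ^ p| ≤ 2 ^ p * |q| ^ p := h3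
      _ ≤ (C + 2 ^ p) * (|q| ^ p + |q| ^ ε * a ^ (p - ε)) := by gcongr <;> linarith

end PosPow

/-- The hypotheses on a solution `Y` of the distributional equation `Y =d Q + M * Y`, with the
a.s. positivity of `M` replaced by positivity. -/
structure IsPerpetuity {Ω : Type*} [MeasurableSpace Ω] (μ : Measure Ω) (M Q Y : Ω → ℝ) (β : ℝ) :
    Prop where
  measurable_M : Measurable M
  measurable_Q : Measurable Q
  measurable_Y : Measurable Y
  M_pos : ∀ ω, 0 < M ω
  M_ne_one : 0 < μ {ω | M ω ≠ 1}
  β_pos : 0 < β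
  integrable_M : Integrable (fun ω => M ω ^ β) μ
  integral_M : ∫ ω, M ω ^ β ∂μ = 1
  integrable_log : Integrable (fun ω => M ω ^ β * max (Real.log (M ω)) 0) μ
  integrable_Q : Integrable (fun ω => |Q ω| ^ β) μ
  indep : IndepFun Y (fun ω => (M ω, Q ω)) μ
  map_eq : Measure.map Y μ = Measure.map (fun ω => Q ω + M ω * Y ω) μ

namespace IsPerpetuity

variable {Ω : Type*} [MeasurableSpace Ω] {μ : Measure Ω} {M Q Y : Ω → ℝ} {β : ℝ}

theorem integral_comp_eq (h : IsPerpetuity μ M Q Y β) {φ : ℝ → ℝ} (hφ : Measurable φ) :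
    ∫ ω, φ (Y ω) ∂μ = ∫ ω, φ (Q ω + M ω * Y ω) ∂μ := by
  have hM := h.measurable_M
  have hQ := h.measurable_Q
  have hY := h.measurable_Y
  rw [← integral_map hY.aemeasurable hφ.aestronglyMeasurable, h.map_eq,
    integral_map (by fun_prop) hφ.aestronglyMeasurable]

theorem integrable_mul (h : IsPerpetuity μ M Q Y β) {f : ℝ × ℝ → ℝ} {g : ℝ → ℝ}
    (hf : Measurable f) (hg : Measurable g) (hfi : Integrable (fun ω => f (M ω, Q ω)) μ)
    (hgi : Integrable (fun ω => g (Y ω)) μ) :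
    Integrable (fun ω => f (M ω, Q ω) * g (Y ω)) μ :=
  IndepFun.integrable_mul (h.indep.symm.comp hf hg) hfi hgi

theorem integral_mul (h : IsPerpetuity μ M Q Y β) {f : ℝ × ℝ → ℝ} {g : ℝ → ℝ}
    (hf : Measurable f) (hg : Measurable g) :
    ∫ ω, f (M ω, Q ω) * g (Y ω) ∂μ = (∫ ω, f (M ω, Q ω) ∂μ) * ∫ ω, g (Y ω) ∂μ :=
  IndepFun.integral_comp_mul_comp h.indep.symm
    (h.measurable_M.prodMk h.measurable_Q).aemeasurable h.measurable_Y.aemeasurable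
    hf.aestronglyMeasurable hg.aestronglyMeasurable

theorem indicator_mul_le_min_sub_min (h : IsPerpetuity μ M Q Y β) (p v : ℝ) (ω : Ω) :
    (1 - M ω ^ p) * {x | posPow p x ≤ v}.indicator (posPow p) (Y ω)
      ≤ min (posPow p (Y ω)) v - min (posPow p (M ω * Y ω)) v := by
  by_cases hx : Y ω ∈ {x | posPow p x ≤ v}
  · rw [Set.indicator_of_mem hx, min_eq_left hx, posPow_mul (h.M_pos ω).le]
    linarith [min_le_left (M ω ^ p * posPow p (Y ω)) v]
  · rw [Set.indicator_of_notMem hx, mul_zero, min_eq_right (not_le.1 hx).le]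
    linarith [min_le_right (posPow p (M ω * Y ω)) v]

/-- The law of `log M` under the change of measure with density `M ^ β`. -/
noncomputable def tiltedLaw {Ω : Type*} [MeasurableSpace Ω] (μ : Measure Ω) (M : Ω → ℝ)
    (β : ℝ) : Measure ℝ :=
  (μ.withDensity fun ω => ENNReal.ofReal (M ω ^ β)).map fun ω => Real.log (M ω)

theorem isProbabilityMeasure_tiltedLaw (h : IsPerpetuity μ M Q Y β) :
    IsProbabilityMeasure (tiltedLaw μ M β) := by
  have hM := h.measurable_M
  have : IsProbabilityMeasure (μ.withDensity fun ω => ENNReal.ofReal (M ω ^ β)) := by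
    refine ⟨?_⟩
    rw [withDensity_apply _ MeasurableSet.univ, Measure.restrict_univ,
      ← ofReal_integral_eq_lintegral_ofReal h.integrable_M
        (ae_of_all _ fun ω => rpow_nonneg (h.M_pos ω).le β), h.integral_M, ENNReal.ofReal_one]
  exact Measure.isProbabilityMeasure_map (by fun_prop)

theorem integral_tiltedLaw (h : IsPerpetuity μ M Q Y β) {f : ℝ → ℝ} (hf : Measurable f) :
    ∫ y, f y ∂(tiltedLaw μ M β) = ∫ ω, M ω ^ β * f (Real.log (M ω)) ∂μ := by
  have hM := h.measurable_M
  rw [tiltedLaw, integral_map (by fun_prop) hf.aestronglyMeasurable,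
    integral_withDensity_eq_integral_toReal_smul (by fun_prop)
      (ae_of_all _ fun ω => ENNReal.ofReal_lt_top)]
  refine integral_congr_ae (ae_of_all _ fun ω => ?_)
  simp only [ENNReal.toReal_ofReal (rpow_nonneg (h.M_pos ω).le β), smul_eq_mul]

theorem integrable_tiltedLaw_iff (h : IsPerpetuity μ M Q Y β) {f : ℝ → ℝ} (hf : Measurable f) :
    Integrable f (tiltedLaw μ M β) ↔ Integrable (fun ω => M ω ^ β * f (Real.log (M ω))) μ := by
  have hM := h.measurable_M
  rw [tiltedLaw, integrable_map_measure hf.aestronglyMeasurable (by fun_prop),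
    integrable_withDensity_iff_integrable_smul' (by fun_prop)
      (ae_of_all _ fun ω => ENNReal.ofReal_lt_top)]
  refine integrable_congr (ae_of_all _ fun ω => ?_)
  simp only [ENNReal.toReal_ofReal (rpow_nonneg (h.M_pos ω).le β), smul_eq_mul,
    Function.comp_apply]

theorem ae_of_ae_tiltedLaw (h : IsPerpetuity μ M Q Y β) {p : ℝ → Prop}
    (hp : ∀ᵐ y ∂(tiltedLaw μ M β), p y) : ∀ᵐ ω ∂μ, p (Real.log (M ω)) := by
  have hM := h.measurable_M
  have h1 := ae_of_ae_map (by fun_prop) hp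
  rw [ae_withDensity_iff (by fun_prop)] at h1
  filter_upwards [h1] with ω hω
  exact hω (by simpa using rpow_pos_of_pos (h.M_pos ω) β)

theorem tendsto_integral_indicator_lt {f X : Ω → ℝ} (hf : Integrable f μ) (hX : Measurable X) :
    Tendsto (fun t => ∫ ω, {ω | t < X ω}.indicator f ω ∂μ) atTop (nhds 0) := by
  rw [show nhds (0 : ℝ) = nhds (∫ _ : Ω, (0 : ℝ) ∂μ) by simp]
  refine tendsto_integral_filter_of_dominated_convergence (fun ω => ‖f ω‖)
    (Eventually.of_forall fun t => ?_)
    (Eventually.of_forall fun t => ae_of_all _ fun ω => norm_indicator_le_norm_self _ _) hf.norm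
    (ae_of_all _ fun ω => ?_)
  · exact hf.aestronglyMeasurable.indicator (measurableSet_lt measurable_const hX)
  · refine tendsto_const_nhds.congr' ?_
    filter_upwards [eventually_ge_atTop (X ω)] with t ht
    rw [Set.indicator_of_notMem (show ω ∉ {ω | t < X ω} from not_lt.2 ht)]

variable [IsProbabilityMeasure μ]

theorem map_prodMk (h : IsPerpetuity μ M Q Y β) :
    μ.map (fun ω => (Y ω, (M ω, Q ω))) = (μ.map Y).prod (μ.map fun ω => (M ω, Q ω)) :=
  (indepFun_iff_map_prod_eq_prod_map_map h.measurable_Y.aemeasurable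
    (h.measurable_M.prodMk h.measurable_Q).aemeasurable).1 h.indep

theorem integrable_prod (h : IsPerpetuity μ M Q Y β) {g : ℝ → ℝ × ℝ → ℝ}
    (hg : Measurable (Function.uncurry g)) (hi : Integrable (fun ω => g (Y ω) (M ω, Q ω)) μ) :
    Integrable (Function.uncurry g) ((μ.map Y).prod (μ.map fun ω => (M ω, Q ω))) := by
  have hM := h.measurable_M
  have hQ := h.measurable_Q
  have hY := h.measurable_Y
  rw [← h.map_prodMk, integrable_map_measure hg.aestronglyMeasurable (by fun_prop)]
  exact hi

/-- Fubini's theorem, integrating over `Y` first. -/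
theorem integral_eq_integral_integral (h : IsPerpetuity μ M Q Y β) {g : ℝ → ℝ × ℝ → ℝ}
    (hg : Measurable (Function.uncurry g)) (hi : Integrable (fun ω => g (Y ω) (M ω, Q ω)) μ) :
    ∫ ω, g (Y ω) (M ω, Q ω) ∂μ = ∫ ω, ∫ ω', g (Y ω') (M ω, Q ω) ∂μ ∂μ := by
  have hM := h.measurable_M
  have hQ := h.measurable_Q
  have hY := h.measurable_Y
  have h1 := h.integrable_prod hg hi
  have : IsProbabilityMeasure (μ.map Y) := Measure.isProbabilityMeasure_map hY.aemeasurable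
  have : IsProbabilityMeasure (μ.map fun ω => (M ω, Q ω)) :=
    Measure.isProbabilityMeasure_map (by fun_prop)
  have h2 : ∫ ω, g (Y ω) (M ω, Q ω) ∂μ
      = ∫ z, Function.uncurry g z ∂((μ.map Y).prod (μ.map fun ω => (M ω, Q ω))) := by
    rw [← h.map_prodMk, integral_map (by fun_prop) hg.aestronglyMeasurable]
    rfl
  rw [h2, integral_prod_symm _ h1, integral_map (by fun_prop)
    h1.integral_prod_right.aestronglyMeasurable]
  refine integral_congr_ae (ae_of_all _ fun ω => ?_)
  exact integral_map hY.aemeasurable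
    (hg.comp (measurable_id.prodMk measurable_const)).aestronglyMeasurable

/-- Fubini's theorem, integrating over `(M, Q)` first. -/
theorem integral_eq_integral_integral_symm (h : IsPerpetuity μ M Q Y β) {g : ℝ → ℝ × ℝ → ℝ}
    (hg : Measurable (Function.uncurry g)) (hi : Integrable (fun ω => g (Y ω) (M ω, Q ω)) μ) :
    Integrable (fun ω => ∫ ω', g (Y ω) (M ω', Q ω') ∂μ) μ ∧
    ∫ ω, g (Y ω) (M ω, Q ω) ∂μ = ∫ ω, ∫ ω', g (Y ω) (M ω', Q ω') ∂μ ∂μ := by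
  have hM := h.measurable_M
  have hQ := h.measurable_Q
  have hY := h.measurable_Y
  have h1 := h.integrable_prod hg hi
  have : IsProbabilityMeasure (μ.map Y) := Measure.isProbabilityMeasure_map hY.aemeasurable
  have : IsProbabilityMeasure (μ.map fun ω => (M ω, Q ω)) :=
    Measure.isProbabilityMeasure_map (by fun_prop)
  have h2 : ∫ ω, g (Y ω) (M ω, Q ω) ∂μ
      = ∫ z, Function.uncurry g z ∂((μ.map Y).prod (μ.map fun ω => (M ω, Q ω))) := by
    rw [← h.map_prodMk, integral_map (by fun_prop) hg.aestronglyMeasurable]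
    rfl
  have h3 : ∀ y, ∫ z, Function.uncurry g (y, z) ∂(μ.map fun ω => (M ω, Q ω))
      = ∫ ω', g y (M ω', Q ω') ∂μ := fun y => integral_map (by fun_prop)
    (hg.comp (measurable_const.prodMk measurable_id)).aestronglyMeasurable
  have h4 := h1.integral_prod_left
  simp_rw [h3] at h4
  constructor
  · exact (integrable_map_measure h4.aestronglyMeasurable hY.aemeasurable).1 h4
  · rw [h2, integral_prod _ h1]
    simp_rw [h3]
    exact integral_map hY.aemeasurable h4.aestronglyMeasurable

theorem integrable_M_rpow (h : IsPerpetuity μ M Q Y β) {p : ℝ} (hp0 : 0 ≤ p) (hp : p ≤ β) :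
    Integrable (fun ω => M ω ^ p) μ := by
  have hM := h.measurable_M
  refine ((integrable_const 1).add h.integrable_M).mono' (by fun_prop) (ae_of_all _ fun ω => ?_)
  have hm := h.M_pos ω
  rw [norm_of_nonneg (rpow_nonneg hm.le p)]
  have := rpow_nonneg hm.le β
  simp only [Pi.add_apply]
  rcases le_total (M ω) 1 with h1 | h1
  · linarith [rpow_le_one hm.le h1 hp0]
  · linarith [rpow_le_rpow_of_exponent_le h1 hp]

theorem integrable_Q_rpow (h : IsPerpetuity μ M Q Y β) {p : ℝ} (hp0 : 0 ≤ p) (hp : p ≤ β) :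
    Integrable (fun ω => |Q ω| ^ p) μ := by
  have hQ := h.measurable_Q
  refine ((integrable_const 1).add h.integrable_Q).mono' (by fun_prop) (ae_of_all _ fun ω => ?_)
  have hm := abs_nonneg (Q ω)
  rw [norm_of_nonneg (rpow_nonneg hm p)]
  have := rpow_nonneg hm β
  simp only [Pi.add_apply]
  rcases le_total |Q ω| 1 with h1 | h1
  · linarith [rpow_le_one hm h1 hp0]
  · linarith [rpow_le_rpow_of_exponent_le h1 hp]

theorem integrable_Q_rpow_mul_M_rpow (h : IsPerpetuity μ M Q Y β) {p ε : ℝ} (hε : 0 ≤ ε)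
    (hεp : ε ≤ p) (hp : p ≤ β) : Integrable (fun ω => |Q ω| ^ ε * M ω ^ (p - ε)) μ := by
  have hM := h.measurable_M
  have hQ := h.measurable_Q
  refine ((h.integrable_Q_rpow (hε.trans hεp) hp).add
    (h.integrable_M_rpow (hε.trans hεp) hp)).mono' (by fun_prop) (ae_of_all _ fun ω => ?_)
  have hm := h.M_pos ω
  have hq := abs_nonneg (Q ω)
  rw [norm_of_nonneg (mul_nonneg (rpow_nonneg hq _) (rpow_nonneg hm.le _))]
  simp only [Pi.add_apply]
  have h1 : |Q ω| ^ ε * M ω ^ (p - ε) ≤ max |Q ω| (M ω) ^ p := by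
    have h0 : 0 < max |Q ω| (M ω) := lt_max_of_lt_right hm
    calc |Q ω| ^ ε * M ω ^ (p - ε) ≤ max |Q ω| (M ω) ^ ε * max |Q ω| (M ω) ^ (p - ε) := by
          gcongr
          · exact le_max_left _ _
          · exact le_max_right _ _
      _ = max |Q ω| (M ω) ^ p := by rw [← rpow_add h0]; congr 1; ring
  have h2 := rpow_nonneg hq p
  have h3 := rpow_nonneg hm.le p
  rcases max_cases |Q ω| (M ω) with h4 | h4 <;> rw [h4.1] at h1 <;> linarith

theorem integral_M_rpow_lt_one (h : IsPerpetuity μ M Q Y β) {p : ℝ} (hp0 : 0 < p) (hp : p < β) :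
    ∫ ω, M ω ^ p ∂μ < 1 := by
  have hM := h.measurable_M
  have hβ := h.β_pos
  set f : Ω → ℝ := fun ω => 1 + p / β * (M ω ^ β - 1) - M ω ^ p with hf
  have hlt : ∀ ω, M ω ≠ 1 → 0 < f ω := by
    intro ω hω
    have hm := h.M_pos ω
    have hpos := rpow_pos_of_pos hm β
    have h1 := rpow_one_add_lt_one_add_mul_self (s := M ω ^ β - 1) (by linarith) (by
      intro h0
      have h1 : M ω ^ β = 1 ^ β := by rw [one_rpow]; linarith
      exact hω ((rpow_left_inj hm.le zero_le_one hβ.ne').1 h1))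
      (div_pos hp0 hβ) ((div_lt_one hβ).2 hp)
    rw [add_sub_cancel, ← rpow_mul hm.le, mul_div_cancel₀ _ hβ.ne'] at h1
    simp only [hf]
    linarith
  have hnn : 0 ≤ f := fun ω => by
    rcases eq_or_ne (M ω) 1 with h1 | h1
    · simp [hf, h1]
    · exact (hlt ω h1).le
  have hi0 : Integrable (fun ω => M ω ^ β - 1) μ := h.integrable_M.sub (integrable_const _)
  have hi1 : Integrable (fun ω => 1 + p / β * (M ω ^ β - 1)) μ :=
    (integrable_const _).add (hi0.const_mul _)
  have hi2 := h.integrable_M_rpow hp0.le hp.le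
  have hpos : 0 < ∫ ω, f ω ∂μ := by
    rw [integral_pos_iff_support_of_nonneg hnn (hi1.sub hi2)]
    exact h.M_ne_one.trans_le (measure_mono fun ω hω => (hlt ω hω).ne')
  have hval : ∫ ω, f ω ∂μ = 1 - ∫ ω, M ω ^ p ∂μ := by
    simp only [hf]
    rw [integral_sub hi1 hi2, integral_add (integrable_const _) (hi0.const_mul _),
      integral_const_mul,
      integral_sub h.integrable_M (integrable_const _), h.integral_M]
    simp
  linarith

theorem integrable_M_rpow_mul_log (h : IsPerpetuity μ M Q Y β) :
    Integrable (fun ω => M ω ^ β * Real.log (M ω)) μ := by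
  have hM := h.measurable_M
  have hβ := h.β_pos
  refine ((integrable_const (1 / β)).add h.integrable_log).mono' (by fun_prop)
    (ae_of_all _ fun ω => ?_)
  have hm := h.M_pos ω
  have hpos := rpow_pos_of_pos hm β
  simp only [Pi.add_apply]
  rw [Real.norm_eq_abs, abs_mul, abs_of_pos hpos]
  rcases le_total (M ω) 1 with h1 | h1
  · have hl := Real.log_nonpos hm.le h1
    rw [max_eq_right hl, abs_of_nonpos hl, mul_zero, add_zero]
    have h2 := Real.one_sub_inv_le_log_of_pos hpos
    rw [Real.log_rpow hm] at h2
    have h3 : M ω ^ β * (1 - (M ω ^ β)⁻¹) = M ω ^ β - 1 := by field_simp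
    rw [le_div_iff₀ hβ]
    nlinarith
  · have hl := Real.log_nonneg h1
    rw [max_eq_left hl, abs_of_nonneg hl]
    linarith [one_div_pos.2 hβ]

theorem integral_M_rpow_mul_log_pos (h : IsPerpetuity μ M Q Y β) :
    0 < ∫ ω, M ω ^ β * Real.log (M ω) ∂μ := by
  have hM := h.measurable_M
  have hβ := h.β_pos
  set f : Ω → ℝ := fun ω => β * (M ω ^ β * Real.log (M ω)) - (M ω ^ β - 1) with hf
  have hlt : ∀ ω, M ω ≠ 1 → 0 < f ω := by
    intro ω hω
    have hm := h.M_pos ω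
    have hpos := rpow_pos_of_pos hm β
    have hne : (M ω ^ β)⁻¹ ≠ 1 := by
      intro h0
      have h1 : M ω ^ β = 1 ^ β := by rw [one_rpow]; exact inv_eq_one.1 h0
      exact hω ((rpow_left_inj hm.le zero_le_one hβ.ne').1 h1)
    have h1 := Real.log_lt_sub_one_of_pos (inv_pos.2 hpos) hne
    rw [Real.log_inv, Real.log_rpow hm] at h1
    have h3 : M ω ^ β * ((M ω ^ β)⁻¹ - 1) = 1 - M ω ^ β := by field_simp
    have h4 := mul_lt_mul_of_pos_left h1 hpos
    simp only [hf]
    nlinarith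
  have hnn : 0 ≤ f := fun ω => by
    rcases eq_or_ne (M ω) 1 with h1 | h1
    · simp [hf, h1]
    · exact (hlt ω h1).le
  have hi1 := h.integrable_M_rpow_mul_log.const_mul β
  have hi2 : Integrable (fun ω => M ω ^ β - 1) μ := h.integrable_M.sub (integrable_const _)
  have hpos : 0 < ∫ ω, f ω ∂μ := by
    rw [integral_pos_iff_support_of_nonneg hnn (hi1.sub hi2)]
    exact h.M_ne_one.trans_le (measure_mono fun ω hω => (hlt ω hω).ne')
  have hval : ∫ ω, f ω ∂μ = β * ∫ ω, M ω ^ β * Real.log (M ω) ∂μ := by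
    simp only [hf]
    rw [integral_sub hi1 hi2, integral_const_mul, integral_sub h.integrable_M (integrable_const _),
      h.integral_M]
    simp
  rw [hval] at hpos
  exact pos_of_mul_pos_right hpos hβ.le

theorem exists_measure_M_le_pos (h : IsPerpetuity μ M Q Y β) :
    ∃ a, 0 < a ∧ a < 1 ∧ 0 < μ.real {ω | M ω ≤ a} := by
  have hM := h.measurable_M
  have hβ := h.β_pos
  have h1 : μ (⋃ n : ℕ, {ω | M ω ≤ 1 - 1 / ((n : ℝ) + 2)}) ≠ 0 := by
    intro h0
    have hge : ∀ᵐ ω ∂μ, 1 ≤ M ω := by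
      have : ∀ᵐ ω ∂μ, ω ∉ ⋃ n : ℕ, {ω | M ω ≤ 1 - 1 / ((n : ℝ) + 2)} :=
        measure_eq_zero_iff_ae_notMem.1 h0
      filter_upwards [this] with ω hω
      by_contra! hlt
      apply hω
      obtain ⟨n, hn⟩ := exists_nat_one_div_lt (show 0 < 1 - M ω by linarith)
      refine Set.mem_iUnion.2 ⟨n, ?_⟩
      have : 1 / ((n : ℝ) + 2) ≤ 1 / ((n : ℝ) + 1) := by
        apply one_div_le_one_div_of_le <;> [positivity; linarith]
      simp only [Set.mem_ofPred_eq]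
      linarith
    have hi : Integrable (fun ω => M ω ^ β - 1) μ := h.integrable_M.sub (integrable_const _)
    have hz : ∫ ω, (M ω ^ β - 1) ∂μ = 0 := by
      rw [integral_sub h.integrable_M (integrable_const _), h.integral_M]; simp
    rw [integral_eq_zero_iff_of_nonneg_ae (by
      filter_upwards [hge] with ω hω
      simpa using one_le_rpow hω hβ.le) hi] at hz
    have : ∀ᵐ ω ∂μ, M ω = 1 := by
      filter_upwards [hz] with ω hω
      have h1 : M ω ^ β = 1 ^ β := by
        rw [one_rpow]; simpa [sub_eq_zero] using hω
      exact (rpow_left_inj (h.M_pos ω).le zero_le_one hβ.ne').1 h1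
    exact h.M_ne_one.ne' (ae_iff.1 this)
  obtain ⟨n, hn⟩ := exists_measure_pos_of_not_measure_iUnion_null h1
  refine ⟨1 - 1 / ((n : ℝ) + 2), ?_, ?_, ENNReal.toReal_pos hn.ne' (measure_ne_top _ _)⟩
  · have : 1 / ((n : ℝ) + 2) < 1 := by
      rw [div_lt_one (by positivity)]; linarith [n.cast_nonneg (α := ℝ)]
    linarith
  · have : 0 < 1 / ((n : ℝ) + 2) := by positivity
    linarith

/-- The increments `(MY + Q)₊ ^ p - (MY)₊ ^ p` have an integrable majorant as soon as `Y₊` has a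
slightly smaller moment. -/
theorem exists_integrable_bound (h : IsPerpetuity μ M Q Y β) {p ε : ℝ} (hε : 0 < ε) (hε1 : ε ≤ 1)
    (hεp : ε ≤ p) (hp : p ≤ β) (hY : Integrable (fun ω => posPow (p - ε) (Y ω)) μ) :
    ∃ D : Ω → ℝ, Integrable D μ ∧
      ∀ ω, |posPow p (Q ω + M ω * Y ω) - posPow p (M ω * Y ω)| ≤ D ω := by
  obtain ⟨C, hC0, hC⟩ := exists_abs_posPow_add_sub_le hε hε1 hεp
  have h1 := h.integrable_mul (f := fun z => |z.2| ^ ε * z.1 ^ (p - ε)) (g := posPow (p - ε))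
    (by fun_prop) (by fun_prop) (h.integrable_Q_rpow_mul_M_rpow hε.le hεp hp) hY
  refine ⟨_, ((h.integrable_Q_rpow (hε.le.trans hεp) hp).add h1).const_mul C, fun ω => ?_⟩
  have h2 := hC (M ω * Y ω) (Q ω)
  rw [posPow_mul (h.M_pos ω).le (p - ε), ← mul_assoc, add_comm (M ω * Y ω)] at h2
  exact h2

theorem integrable_min_posPow {X : Ω → ℝ} (hX : Measurable X) (p : ℝ) {v : ℝ} (hv : 0 ≤ v) :
    Integrable (fun ω => min (posPow p (X ω)) v) μ := by
  refine Integrable.of_bound (Measurable.aestronglyMeasurable (by fun_prop)) v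
    (ae_of_all _ fun ω => ?_)
  rw [norm_of_nonneg (le_min (posPow_nonneg _ _) hv)]
  exact min_le_right _ _

theorem integrable_indicator_posPow {X : Ω → ℝ} (hX : Measurable X) (p : ℝ) (v : ℝ) :
    Integrable (fun ω => {x | posPow p x ≤ v}.indicator (posPow p) (X ω)) μ := by
  have hm : MeasurableSet {x | posPow p x ≤ v} :=
    measurableSet_le (measurable_posPow p) measurable_const
  refine Integrable.of_bound (((measurable_posPow p).indicator hm).comp hX).aestronglyMeasurable
    (max v 0) (ae_of_all _ fun ω => ?_)
  by_cases hx : X ω ∈ {x | posPow p x ≤ v}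
  · rw [Set.indicator_of_mem hx, norm_of_nonneg (posPow_nonneg _ _)]
    exact le_max_of_le_left hx
  · rw [Set.indicator_of_notMem hx, norm_zero]
    exact le_max_right _ _

theorem integral_min_posPow_sub (h : IsPerpetuity μ M Q Y β) (p : ℝ) {v : ℝ} (hv : 0 ≤ v) :
    ∫ ω, (min (posPow p (Y ω)) v - min (posPow p (M ω * Y ω)) v) ∂μ
      = ∫ ω, (min (posPow p (Q ω + M ω * Y ω)) v - min (posPow p (M ω * Y ω)) v) ∂μ := by
  have hM := h.measurable_M
  have hQ := h.measurable_Q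
  have hY := h.measurable_Y
  rw [integral_sub (integrable_min_posPow hY p hv) (integrable_min_posPow (by fun_prop) p hv),
    integral_sub (integrable_min_posPow (by fun_prop) p hv)
      (integrable_min_posPow (by fun_prop) p hv),
    h.integral_comp_eq (φ := fun y => min (posPow p y) v) (by fun_prop)]

theorem exists_integral_min_posPow_sub_le (h : IsPerpetuity μ M Q Y β) {p ε : ℝ} (hε : 0 < ε)
    (hε1 : ε ≤ 1) (hεp : ε ≤ p) (hp : p ≤ β)
    (hYi : Integrable (fun ω => posPow (p - ε) (Y ω)) μ) :
    ∃ C, ∀ v, 0 ≤ v →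
      ∫ ω, (min (posPow p (Y ω)) v - min (posPow p (M ω * Y ω)) v) ∂μ ≤ C := by
  have hM := h.measurable_M
  have hQ := h.measurable_Q
  have hY := h.measurable_Y
  obtain ⟨D, hDi, hD⟩ := h.exists_integrable_bound hε hε1 hεp hp hYi
  refine ⟨∫ ω, D ω ∂μ, fun v hv => ?_⟩
  rw [h.integral_min_posPow_sub p hv]
  refine integral_mono ((integrable_min_posPow (by fun_prop) p hv).sub
    (integrable_min_posPow (by fun_prop) p hv)) hDi fun ω => ?_
  have h1 := abs_min_sub_min_le_max (posPow p (Q ω + M ω * Y ω)) v (posPow p (M ω * Y ω)) v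
  rw [sub_self, abs_zero, max_eq_left (abs_nonneg _)] at h1
  exact (le_abs_self _).trans (h1.trans (hD ω))

theorem integrable_one_sub_mul_indicator (h : IsPerpetuity μ M Q Y β) {p : ℝ} (hp0 : 0 ≤ p)
    (hp : p ≤ β) (v : ℝ) :
    Integrable (fun ω => (1 - M ω ^ p) * {x | posPow p x ≤ v}.indicator (posPow p) (Y ω)) μ :=
  h.integrable_mul (f := fun z => 1 - z.1 ^ p) (by fun_prop)
    ((measurable_posPow p).indicator (measurableSet_le (measurable_posPow p) measurable_const))
    ((integrable_const _).sub (h.integrable_M_rpow hp0 hp))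
    (integrable_indicator_posPow h.measurable_Y p v)

theorem integral_one_sub_mul_indicator (h : IsPerpetuity μ M Q Y β) {p : ℝ} (hp0 : 0 ≤ p)
    (hp : p ≤ β) (v : ℝ) :
    ∫ ω, (1 - M ω ^ p) * {x | posPow p x ≤ v}.indicator (posPow p) (Y ω) ∂μ
      = (1 - ∫ ω, M ω ^ p ∂μ) * ∫ ω, {x | posPow p x ≤ v}.indicator (posPow p) (Y ω) ∂μ := by
  rw [h.integral_mul (f := fun z => 1 - z.1 ^ p) (by fun_prop)
    ((measurable_posPow p).indicator (measurableSet_le (measurable_posPow p) measurable_const)),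
    integral_sub (integrable_const _) (h.integrable_M_rpow hp0 hp)]
  simp

theorem integrable_posPow_of_lt (h : IsPerpetuity μ M Q Y β) {ε : ℝ} (hε : 0 < ε) (hε1 : ε ≤ 1)
    (k : ℕ) (hk : k * ε < β) : Integrable (fun ω => posPow (k * ε) (Y ω)) μ := by
  have hM := h.measurable_M
  have hQ := h.measurable_Q
  have hY := h.measurable_Y
  induction k with
  | zero => simp [posPow]
  | succ k ih =>
    have hkε : ((k + 1 : ℕ) : ℝ) * ε = k * ε + ε := by push_cast; ring
    have hk0 : 0 ≤ (k : ℝ) * ε := by positivity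
    set p := ((k + 1 : ℕ) : ℝ) * ε with hp
    have hp0 : 0 < p := by linarith
    have ih' := ih (by linarith)
    rw [show (k : ℝ) * ε = p - ε by linarith] at ih'
    obtain ⟨C, hC⟩ := h.exists_integral_min_posPow_sub_le hε hε1 (by linarith) hk.le ih'
    have hδ : 0 < 1 - ∫ ω, M ω ^ p ∂μ := by linarith [h.integral_M_rpow_lt_one hp0 hk]
    have hcover : AECover μ atTop (fun n : ℕ => {ω | posPow p (Y ω) ≤ n}) := by
      refine ⟨ae_of_all _ fun ω => ?_, fun n => measurableSet_le (by fun_prop) measurable_const⟩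
      exact (tendsto_natCast_atTop_atTop (R := ℝ)).eventually_ge_atTop _
    have hset : ∀ n : ℕ, MeasurableSet {ω | posPow p (Y ω) ≤ n} := fun n =>
      measurableSet_le (by fun_prop) measurable_const
    have hind : ∀ n : ℕ, (fun ω => {x | posPow p x ≤ n}.indicator (posPow p) (Y ω))
        = {ω | posPow p (Y ω) ≤ n}.indicator (fun ω => posPow p (Y ω)) := fun n => rfl
    refine hcover.integrable_of_integral_bounded_of_nonneg_ae (C / (1 - ∫ ω, M ω ^ p ∂μ))
      (fun n => ?_) (ae_of_all _ fun ω => posPow_nonneg _ _) (Eventually.of_forall fun n => ?_)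
    · rw [← integrable_indicator_iff (hset n), ← hind]
      exact integrable_indicator_posPow hY p n
    · rw [← integral_indicator (hset n), ← hind, le_div_iff₀ hδ, mul_comm,
        ← h.integral_one_sub_mul_indicator hp0.le hk.le]
      exact (integral_mono (h.integrable_one_sub_mul_indicator hp0.le hk.le n)
        ((integrable_min_posPow hY p n.cast_nonneg).sub
          (integrable_min_posPow (by fun_prop) p n.cast_nonneg))
        fun ω => h.indicator_mul_le_min_sub_min p n ω).trans (hC n n.cast_nonneg)

/-- A moment of `Y₊` of order smaller than `β` by at most one, together with the exponent gap. -/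
theorem exists_integrable_posPow (h : IsPerpetuity μ M Q Y β) :
    ∃ ε, 0 < ε ∧ ε < 1 ∧ ε + ε ≤ β ∧ Integrable (fun ω => posPow (β - ε) (Y ω)) μ ∧
      Integrable (fun ω => posPow (β - ε - ε) (Y ω)) μ := by
  have hβ := h.β_pos
  obtain ⟨n, hn⟩ := exists_nat_gt β
  have hpos : (0 : ℝ) < n + 2 := by positivity
  set ε := β / (n + 2) with hε
  have hε0 : 0 < ε := by positivity
  have hε1 : ε < 1 := by rw [hε, div_lt_one hpos]; linarith
  have h1 : ((n + 1 : ℕ) : ℝ) * ε = β - ε := by rw [hε]; push_cast; field_simp; ring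
  have h2 : (n : ℝ) * ε = β - ε - ε := by rw [hε]; field_simp; ring
  have h3 : 0 ≤ (n : ℝ) * ε := by positivity
  refine ⟨ε, hε0, hε1, by linarith, ?_, ?_⟩
  · rw [← h1]; exact h.integrable_posPow_of_lt hε0 hε1.le _ (by linarith)
  · rw [← h2]; exact h.integrable_posPow_of_lt hε0 hε1.le _ (by linarith)

/-- The upper tail bound. -/
theorem exists_tail_le (h : IsPerpetuity μ M Q Y β) :
    ∃ B, 0 ≤ B ∧ ∀ u, 0 < u → u ^ β * μ.real {ω | u < Y ω} ≤ B := by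
  have hM := h.measurable_M
  have hQ := h.measurable_Q
  have hY := h.measurable_Y
  have hβ := h.β_pos
  obtain ⟨ε, hε0, hε1, hεβ, hY1, -⟩ := h.exists_integrable_posPow
  obtain ⟨C, hC⟩ := h.exists_integral_min_posPow_sub_le hε0 hε1.le (by linarith) le_rfl hY1
  obtain ⟨a, ha0, ha1, ha⟩ := h.exists_measure_M_le_pos
  set b := a ^ (1 / 2 : ℝ) with hb
  have hb0 : 0 < b := rpow_pos_of_pos ha0 _
  have hb1 : b < 1 := rpow_lt_one ha0.le ha1 (by norm_num)
  have hbb : b * b = a := by rw [hb, ← rpow_add ha0]; norm_num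
  set q := μ.real {ω | M ω ≤ a} with hq
  have hbβ : b ^ β < 1 := rpow_lt_one hb0.le hb1 hβ
  have hbβ0 : 0 < b ^ β := rpow_pos_of_pos hb0 β
  set E := C / ((1 - b ^ β) * q) with hE
  have hband : ∀ u, 0 < u → u ^ β * μ.real {ω | u < Y ω ∧ Y ω ≤ u / b} ≤ E := by
    intro u hu
    have huβ := rpow_pos_of_pos hu β
    have hmf : Measurable ((Set.Iic a ×ˢ Set.univ).indicator (fun _ : ℝ × ℝ => (1 : ℝ))) :=
      measurable_const.indicator (measurableSet_Iic.prod MeasurableSet.univ)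
    have hmg : Measurable ((Set.Ioc u (u / b)).indicator (fun _ : ℝ => (1 : ℝ))) :=
      measurable_const.indicator measurableSet_Ioc
    have hfi : Integrable (fun ω => (Set.Iic a ×ˢ Set.univ).indicator
        (fun _ : ℝ × ℝ => (1 : ℝ)) (M ω, Q ω)) μ := by
      refine Integrable.of_bound (hmf.comp (hM.prodMk hQ)).aestronglyMeasurable 1
        (ae_of_all _ fun ω => ?_)
      exact (norm_indicator_le_norm_self _ _).trans (by simp)
    have hgi : Integrable (fun ω => (Set.Ioc u (u / b)).indicator
        (fun _ : ℝ => (1 : ℝ)) (Y ω)) μ := by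
      refine Integrable.of_bound (hmg.comp hY).aestronglyMeasurable 1 (ae_of_all _ fun ω => ?_)
      exact (norm_indicator_le_norm_self _ _).trans (by simp)
    have hfv : ∫ ω, (Set.Iic a ×ˢ Set.univ).indicator (fun _ : ℝ × ℝ => (1 : ℝ)) (M ω, Q ω) ∂μ
        = q := by
      have hms : MeasurableSet {ω | M ω ≤ a} := hM measurableSet_Iic
      rw [hq, ← integral_indicator_one hms]
      refine integral_congr_ae (ae_of_all _ fun ω => ?_)
      by_cases h1 : M ω ≤ a <;> simp [Set.indicator, h1]
    have hgv : ∫ ω, (Set.Ioc u (u / b)).indicator (fun _ : ℝ => (1 : ℝ)) (Y ω) ∂μ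
        = μ.real {ω | u < Y ω ∧ Y ω ≤ u / b} := by
      have : MeasurableSet {ω | u < Y ω ∧ Y ω ≤ u / b} := hY measurableSet_Ioc
      rw [← integral_indicator_one this]
      rfl
    have hprod := h.integrable_mul hmf hmg hfi hgi
    have hprodv := h.integral_mul hmf hmg
    rw [hfv, hgv] at hprodv
    have hle := (integral_mono ((h.integrable_one_sub_mul_indicator hβ.le le_rfl (u ^ β)).add
      (hprod.const_mul (u ^ β * (1 - b ^ β))))
      ((integrable_min_posPow hY β huβ.le).sub
        (integrable_min_posPow (by fun_prop) β huβ.le)) fun ω => ?_).trans (hC (u ^ β) huβ.le)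
    · simp only [Pi.add_apply] at hle
      rw [integral_add (h.integrable_one_sub_mul_indicator hβ.le le_rfl (u ^ β))
        (hprod.const_mul (u ^ β * (1 - b ^ β))), h.integral_one_sub_mul_indicator hβ.le le_rfl,
        h.integral_M, sub_self, zero_mul, zero_add, integral_const_mul, hprodv] at hle
      rw [hE, le_div_iff₀ (mul_pos (by linarith) ha)]
      calc _ = _ := by ring
        _ ≤ C := hle
    · by_cases hx : M ω ≤ a ∧ u < Y ω ∧ Y ω ≤ u / b
      · obtain ⟨hm, hy1, hy2⟩ := hx
        have h1 : u ^ β < posPow β (Y ω) := (lt_posPow_iff hβ hu.le).2 hy1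
        have h2 : posPow β (M ω * Y ω) ≤ b ^ β * u ^ β := by
          have hy0 := hu.trans hy1
          rw [posPow_of_nonneg (mul_nonneg (h.M_pos ω).le hy0.le), ← mul_rpow hb0.le hu.le]
          refine rpow_le_rpow (mul_nonneg (h.M_pos ω).le hy0.le) ?_ hβ.le
          calc M ω * Y ω ≤ a * (u / b) := by gcongr
            _ = b * u := by rw [← hbb]; field_simp
        have h3 : Y ω ∉ {x | posPow β x ≤ u ^ β} := by simpa using h1
        have h4 := min_le_left (posPow β (M ω * Y ω)) (u ^ β)
        simp only [Pi.add_apply, Pi.sub_apply, Set.indicator_of_notMem h3]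
        rw [Set.indicator_of_mem (by simpa using hm), 
          Set.indicator_of_mem (show Y ω ∈ Set.Ioc u (u / b) from ⟨hy1, hy2⟩),
          min_eq_right h1.le]
        linarith
      · have h1 : (Set.Iic a ×ˢ Set.univ).indicator (fun _ : ℝ × ℝ => (1 : ℝ)) (M ω, Q ω) *
            (Set.Ioc u (u / b)).indicator (fun _ : ℝ => (1 : ℝ)) (Y ω) = 0 := by
          by_cases hm : M ω ≤ a
          · rw [Set.indicator_of_notMem (s := Set.Ioc u (u / b)), mul_zero]
            exact fun hy => hx ⟨hm, hy⟩
          · rw [Set.indicator_of_notMem, zero_mul]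
            simpa using hm
        simp only [Pi.add_apply, Pi.sub_apply, h1, mul_zero, add_zero]
        exact h.indicator_mul_le_min_sub_min β (u ^ β) ω
  have hE0 : 0 ≤ E := (mul_nonneg (rpow_nonneg zero_le_one β) measureReal_nonneg).trans
    (hband 1 one_pos)
  have hiter : ∀ (n : ℕ) (u : ℝ), 0 < u → u ^ β * μ.real {ω | u < Y ω}
      ≤ E / (1 - b ^ β) + u ^ β * μ.real {ω | u / b ^ n < Y ω} := by
    intro n
    induction n with
    | zero =>
      intro u hu
      have : 0 ≤ E / (1 - b ^ β) := div_nonneg hE0 (by linarith)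
      simpa using this
    | succ n ih =>
      intro u hu
      have h1 := ih (u / b) (by positivity)
      have h2 := hband u hu
      have h3 : μ.real {ω | u < Y ω}
          ≤ μ.real {ω | u < Y ω ∧ Y ω ≤ u / b} + μ.real {ω | u / b < Y ω} := by
        refine (measureReal_mono ?_).trans (measureReal_union_le _ _)
        intro ω hω
        rcases le_or_gt (Y ω) (u / b) with h4 | h4
        · exact Or.inl ⟨hω, h4⟩
        · exact Or.inr h4
      rw [show u / b / b ^ n = u / b ^ (n + 1) by field_simp; ring, div_rpow hu.le hb0.le] at h1
      have h4 := mul_le_mul_of_nonneg_left h1 hbβ0.le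
      have h5 : b ^ β * (u ^ β / b ^ β * μ.real {ω | u / b < Y ω})
          = u ^ β * μ.real {ω | u / b < Y ω} := by field_simp
      have h6 : b ^ β * (E / (1 - b ^ β) + u ^ β / b ^ β * μ.real {ω | u / b ^ (n + 1) < Y ω})
          = E / (1 - b ^ β) - E + u ^ β * μ.real {ω | u / b ^ (n + 1) < Y ω} := by
        have : 1 - b ^ β ≠ 0 := by linarith
        field_simp
        ring
      rw [h5, h6] at h4
      have h7 := mul_le_mul_of_nonneg_left h3 (rpow_nonneg hu.le β)
      linarith
  refine ⟨E / (1 - b ^ β), div_nonneg hE0 (by linarith), fun u hu => ?_⟩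
  have hlim : Tendsto (fun n : ℕ => E / (1 - b ^ β) + u ^ β * μ.real {ω | u / b ^ n < Y ω}) atTop
      (nhds (E / (1 - b ^ β) + u ^ β * 0)) := by
    refine tendsto_const_nhds.add (Tendsto.const_mul _ ?_)
    have h1 : Tendsto (fun n : ℕ => ∫ ω, {ω | u / b ^ n < Y ω}.indicator (1 : Ω → ℝ) ω ∂μ) atTop
        (nhds (∫ _ω : Ω, (0 : ℝ) ∂μ)) := by
      refine tendsto_integral_of_dominated_convergence (fun _ => 1) (fun n => ?_)
        (integrable_const _) (fun n => ae_of_all _ fun ω => ?_) (ae_of_all _ fun ω => ?_)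
      · exact (measurable_one.indicator
          (measurableSet_lt measurable_const hY)).aestronglyMeasurable
      · exact (norm_indicator_le_norm_self _ _).trans (by simp)
      · have h2 : Tendsto (fun n : ℕ => u / b ^ n) atTop atTop := by
          simp_rw [div_eq_mul_inv, ← inv_pow]
          exact (tendsto_pow_atTop_atTop_of_one_lt (one_lt_inv₀ hb0 |>.2 hb1)).const_mul_atTop hu
        refine tendsto_const_nhds.congr' ?_
        filter_upwards [h2.eventually_ge_atTop (Y ω)] with n hn
        rw [Set.indicator_of_notMem]
        simpa using hn
    rw [integral_zero] at h1
    refine h1.congr fun n => ?_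
    exact integral_indicator_one (measurableSet_lt measurable_const hY)
  rw [mul_zero, add_zero] at hlim
  exact ge_of_tendsto hlim (Eventually.of_forall fun n => hiter n u hu)

/-- The truncated moment `u ↦ E[min (Y₊ ^ β) (u ^ β)]`. -/
noncomputable def truncMoment {Ω : Type*} [MeasurableSpace Ω] (μ : Measure Ω) (Y : Ω → ℝ)
    (β u : ℝ) : ℝ := ∫ ω, min (posPow β (Y ω)) (u ^ β) ∂μ

theorem mul_measureReal_le_truncMoment_sub (hY : Measurable Y) (hβ : 0 < β) {v w : ℝ}
    (hv : 0 ≤ v) (hvw : v ≤ w) :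
    (w ^ β - v ^ β) * μ.real {ω | w < Y ω} ≤ truncMoment μ Y β w - truncMoment μ Y β v := by
  have hw := hv.trans hvw
  have hm : MeasurableSet {ω | w < Y ω} := measurableSet_lt measurable_const hY
  have hpow := rpow_le_rpow hv hvw hβ.le
  rw [truncMoment, truncMoment, ← integral_sub (integrable_min_posPow hY β (rpow_nonneg hw β))
    (integrable_min_posPow hY β (rpow_nonneg hv β)), ← integral_indicator_one hm,
    ← integral_const_mul]
  refine integral_mono (((integrable_const _).indicator hm).const_mul _)
    ((integrable_min_posPow hY β (rpow_nonneg hw β)).sub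
    (integrable_min_posPow hY β (rpow_nonneg hv β))) fun ω => ?_
  by_cases hω : w < Y ω
  · have h1 := (lt_posPow_iff hβ hw).2 hω
    simp only [Set.indicator_of_mem (show ω ∈ {ω | w < Y ω} from hω), Pi.one_apply, mul_one]
    rw [min_eq_right h1.le, min_eq_right (hpow.trans h1.le)]
  · simp only [Set.indicator_of_notMem (show ω ∉ {ω | w < Y ω} from hω), mul_zero, sub_nonneg]
    exact min_le_min_left _ hpow

theorem truncMoment_sub_le_mul_measureReal (hY : Measurable Y) (hβ : 0 < β) {v w : ℝ}
    (hv : 0 ≤ v) (hvw : v ≤ w) :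
    truncMoment μ Y β w - truncMoment μ Y β v ≤ (w ^ β - v ^ β) * μ.real {ω | v < Y ω} := by
  have hw := hv.trans hvw
  have hm : MeasurableSet {ω | v < Y ω} := measurableSet_lt measurable_const hY
  have hpow := rpow_le_rpow hv hvw hβ.le
  rw [truncMoment, truncMoment, ← integral_sub (integrable_min_posPow hY β (rpow_nonneg hw β))
    (integrable_min_posPow hY β (rpow_nonneg hv β)), ← integral_indicator_one hm,
    ← integral_const_mul]
  refine integral_mono ((integrable_min_posPow hY β (rpow_nonneg hw β)).sub
    (integrable_min_posPow hY β (rpow_nonneg hv β)))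
    (((integrable_const _).indicator hm).const_mul _) fun ω => ?_
  by_cases hω : v < Y ω
  · have h1 := (lt_posPow_iff hβ hv).2 hω
    simp only [Set.indicator_of_mem (show ω ∈ {ω | v < Y ω} from hω), Pi.one_apply, mul_one]
    rw [min_eq_right h1.le]
    exact sub_le_sub_right (min_le_right _ _) _
  · have h1 := not_lt.1 (mt (lt_posPow_iff hβ hv).1 hω)
    simp only [Set.indicator_of_notMem (show ω ∉ {ω | v < Y ω} from hω), mul_zero]
    rw [min_eq_left h1, min_eq_left (h1.trans hpow), sub_self]

theorem truncMoment_mono (hY : Measurable Y) (hβ : 0 < β) {v w : ℝ}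
    (hv : 0 ≤ v) (hvw : v ≤ w) : truncMoment μ Y β v ≤ truncMoment μ Y β w := by
  have h1 := mul_measureReal_le_truncMoment_sub (μ := μ) hY hβ hv hvw
  have h2 := mul_nonneg (sub_nonneg.2 (rpow_le_rpow hv hvw hβ.le))
    (measureReal_nonneg (μ := μ) (s := {ω | w < Y ω}))
  linarith

/-- On the logarithmic scale the truncated moment is Lipschitz. -/
theorem exists_truncMoment_exp_sub_le (h : IsPerpetuity μ M Q Y β) :
    ∃ K, 0 ≤ K ∧ ∀ s t, s ≤ t →
      truncMoment μ Y β (rexp t) - truncMoment μ Y β (rexp s) ≤ K * (t - s) := by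
  have hβ := h.β_pos
  obtain ⟨B, hB0, hB⟩ := h.exists_tail_le
  set K := B * (β * rexp β) with hK
  have hK0 : 0 ≤ K := by positivity
  have hloc : ∀ s t, s ≤ t → t ≤ s + 1 →
      truncMoment μ Y β (rexp t) - truncMoment μ Y β (rexp s) ≤ K * (t - s) := by
    intro s t hst hts
    refine (truncMoment_sub_le_mul_measureReal h.measurable_Y hβ (exp_pos s).le
      (exp_le_exp.2 hst)).trans ?_
    have h1 : rexp t ^ β - rexp s ^ β = (rexp (β * (t - s)) - 1) * rexp s ^ β := by
      rw [← exp_mul, ← exp_mul, sub_mul, ← exp_add, one_mul]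
      ring_nf
    have h2 : rexp (β * (t - s)) - 1 ≤ β * rexp β * (t - s) := by
      have h3 := add_one_le_exp (-(β * (t - s)))
      have h4 : rexp (-(β * (t - s))) * rexp (β * (t - s)) = 1 := by
        rw [← exp_add, neg_add_cancel, exp_zero]
      have h5 : rexp (β * (t - s)) ≤ rexp β := exp_le_exp.2 (by nlinarith)
      have h6 := mul_le_mul_of_nonneg_right h3 (exp_pos (β * (t - s))).le
      have h7 : 0 ≤ β * (t - s) := mul_nonneg hβ.le (sub_nonneg.2 hst)
      have h8 := mul_le_mul_of_nonneg_left h5 h7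
      nlinarith
    have h3 : 0 ≤ rexp (β * (t - s)) - 1 :=
      sub_nonneg.2 (one_le_exp (mul_nonneg hβ.le (sub_nonneg.2 hst)))
    calc (rexp t ^ β - rexp s ^ β) * μ.real {ω | rexp s < Y ω}
        = (rexp (β * (t - s)) - 1) * (rexp s ^ β * μ.real {ω | rexp s < Y ω}) := by
          rw [h1, mul_assoc]
      _ ≤ (β * rexp β * (t - s)) * B := by
          exact mul_le_mul h2 (hB _ (exp_pos s))
            (mul_nonneg (rpow_nonneg (exp_pos s).le β) measureReal_nonneg) (h3.trans h2)
      _ = K * (t - s) := by rw [hK]; ring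
  have hind : ∀ (n : ℕ) (s t : ℝ), s ≤ t → t ≤ s + n →
      truncMoment μ Y β (rexp t) - truncMoment μ Y β (rexp s) ≤ K * (t - s) := by
    intro n
    induction n with
    | zero =>
      intro s t hst hts
      have : s = t := by push_cast at hts; linarith
      simp [this]
    | succ n ih =>
      intro s t hst hts
      push_cast at hts
      rcases le_total t (s + 1) with h1 | h1
      · exact hloc s t hst h1
      · have h2 := ih (s + 1) t h1 (by linarith)
        have h3 := hloc s (s + 1) (by linarith) le_rfl
        linarith
  refine ⟨K, hK0, fun s t hst => ?_⟩
  obtain ⟨n, hn⟩ := exists_nat_ge (t - s)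
  exact hind n s t hst (by linarith)

theorem exists_abs_truncMoment_exp_sub_le (h : IsPerpetuity μ M Q Y β) :
    ∃ K, 0 ≤ K ∧ ∀ s t,
      |truncMoment μ Y β (rexp s) - truncMoment μ Y β (rexp t)| ≤ K * |s - t| := by
  obtain ⟨K, hK0, hK⟩ := h.exists_truncMoment_exp_sub_le
  have hle : ∀ s t, s ≤ t →
      |truncMoment μ Y β (rexp s) - truncMoment μ Y β (rexp t)| ≤ K * |s - t| := by
    intro s t hst
    have h1 := truncMoment_mono (μ := μ) h.measurable_Y h.β_pos (exp_pos s).le (exp_le_exp.2 hst)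
    rw [abs_of_nonpos (sub_nonpos.2 h1), abs_of_nonpos (sub_nonpos.2 hst), neg_sub, neg_sub]
    exact hK s t hst
  refine ⟨K, hK0, fun s t => ?_⟩
  rcases le_total s t with hst | hst
  · exact hle s t hst
  · rw [abs_sub_comm, abs_sub_comm s]
    exact hle t s hst

/-- The renewal equation for the truncated moment on the logarithmic scale. -/
theorem integral_tiltedLaw_truncMoment_sub (h : IsPerpetuity μ M Q Y β) (t : ℝ) :
    ∫ y, (truncMoment μ Y β (rexp t) - truncMoment μ Y β (rexp (t - y))) ∂(tiltedLaw μ M β)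
      = ∫ ω, (min (posPow β (Y ω)) (rexp t ^ β) - min (posPow β (M ω * Y ω)) (rexp t ^ β)) ∂μ := by
  have hM := h.measurable_M
  have hQ := h.measurable_Q
  have hY := h.measurable_Y
  have hβ := h.β_pos
  obtain ⟨K, hK0, hK⟩ := h.exists_abs_truncMoment_exp_sub_le
  have hcont : Continuous fun t => truncMoment μ Y β (rexp t) := by
    refine (LipschitzWith.of_dist_le_mul (K := ⟨K, hK0⟩) fun s t => ?_).continuous
    exact hK s t
  have hmeas : Measurable fun y =>
      truncMoment μ Y β (rexp t) - truncMoment μ Y β (rexp (t - y)) :=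
    measurable_const.sub (hcont.measurable.comp (measurable_const.sub measurable_id))
  have hv : 0 ≤ rexp t ^ β := rpow_nonneg (exp_pos t).le β
  set v := rexp t ^ β with hvdef
  have hi1 : Integrable (fun ω => M ω ^ β * min (posPow β (Y ω)) v) μ :=
    h.integrable_mul (f := fun z => z.1 ^ β) (g := fun y => min (posPow β y) v)
      (by fun_prop) (by fun_prop) h.integrable_M (integrable_min_posPow hY β hv)
  have hi2 : Integrable (fun ω => min (posPow β (M ω * Y ω)) v) μ :=
    integrable_min_posPow (by fun_prop) β hv
  have hE : ∫ ω, M ω ^ β * min (posPow β (Y ω)) v ∂μ = ∫ ω, min (posPow β (Y ω)) v ∂μ := by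
    rw [h.integral_mul (f := fun z => z.1 ^ β) (g := fun y => min (posPow β y) v)
      (by fun_prop) (by fun_prop), h.integral_M, one_mul]
  have hF := h.integral_eq_integral_integral
    (g := fun y z => z.1 ^ β * min (posPow β y) v - min (posPow β (z.1 * y)) v)
    (by unfold Function.uncurry; fun_prop) (hi1.sub hi2)
  rw [integral_sub hi1 hi2, hE] at hF
  rw [h.integral_tiltedLaw hmeas, integral_sub (integrable_min_posPow hY β hv) hi2, hF]
  refine integral_congr_ae (ae_of_all _ fun ω => ?_)
  have hm := h.M_pos ω
  have hmβ := rpow_pos_of_pos hm β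
  have h1 : ∫ ω', min (posPow β (M ω * Y ω')) v ∂μ
      = M ω ^ β * truncMoment μ Y β (rexp (t - Real.log (M ω))) := by
    rw [truncMoment, ← integral_const_mul]
    refine integral_congr_ae (ae_of_all _ fun ω' => ?_)
    simp only
    rw [exp_sub, exp_log hm, div_rpow (exp_pos t).le hm.le, posPow_mul hm.le,
      mul_min_of_nonneg _ _ hmβ.le, mul_div_cancel₀ _ hmβ.ne']
  simp only
  rw [integral_sub ((integrable_min_posPow hY β hv).const_mul _)
    (integrable_min_posPow (by fun_prop) β hv), h1, integral_const_mul, mul_sub]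
  rfl

theorem exists_tendsto_integral_tiltedLaw (h : IsPerpetuity μ M Q Y β) :
    ∃ H, Tendsto (fun t => ∫ y, (truncMoment μ Y β (rexp t) - truncMoment μ Y β (rexp (t - y)))
      ∂(tiltedLaw μ M β)) atTop (nhds H) := by
  have hM := h.measurable_M
  have hQ := h.measurable_Q
  have hY := h.measurable_Y
  have hβ := h.β_pos
  obtain ⟨ε, hε0, hε1, hεβ, hY1, -⟩ := h.exists_integrable_posPow
  obtain ⟨D, hDi, hD⟩ := h.exists_integrable_bound hε0 hε1.le (by linarith) le_rfl hY1
  refine ⟨∫ ω, (posPow β (Q ω + M ω * Y ω) - posPow β (M ω * Y ω)) ∂μ, ?_⟩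
  simp_rw [h.integral_tiltedLaw_truncMoment_sub,
    fun t => h.integral_min_posPow_sub β (rpow_nonneg (exp_pos t).le β)]
  refine tendsto_integral_filter_of_dominated_convergence D
    (Eventually.of_forall fun t => Measurable.aestronglyMeasurable (by fun_prop))
    (Eventually.of_forall fun t => ae_of_all _ fun ω => ?_) hDi (ae_of_all _ fun ω => ?_)
  · have h1 := abs_min_sub_min_le_max (posPow β (Q ω + M ω * Y ω)) (rexp t ^ β)
      (posPow β (M ω * Y ω)) (rexp t ^ β)
    rw [sub_self, abs_zero, max_eq_left (abs_nonneg _)] at h1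
    exact h1.trans (hD ω)
  · have h1 : Tendsto (fun t => rexp t ^ β) atTop atTop :=
      (tendsto_rpow_atTop hβ).comp tendsto_exp_atTop
    refine tendsto_const_nhds.congr' ?_
    filter_upwards [h1.eventually_ge_atTop (posPow β (Q ω + M ω * Y ω)),
      h1.eventually_ge_atTop (posPow β (M ω * Y ω))] with t h2 h3
    rw [min_eq_left h2, min_eq_left h3]

theorem exists_tendsto_truncMoment_sub (h : IsPerpetuity μ M Q Y β)
    (hna : ¬ ∃ d : ℝ, 0 < d ∧ ∀ᵐ ω ∂μ, ∃ k : ℤ, Real.log (M ω) = k * d) :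
    ∃ c, ∀ x, Tendsto (fun t => truncMoment μ Y β (rexp t) - truncMoment μ Y β (rexp (t - x)))
      atTop (nhds (x * c)) := by
  have := h.isProbabilityMeasure_tiltedLaw
  obtain ⟨K, hK0, hK⟩ := h.exists_abs_truncMoment_exp_sub_le
  obtain ⟨H, hH⟩ := h.exists_tendsto_integral_tiltedLaw
  refine ⟨_, tendsto_increment_of_not_arithmetic (P := tiltedLaw μ M β)
    (a := fun t => truncMoment μ Y β (rexp t)) hK hH ?_ ?_ ?_⟩
  · rw [h.integrable_tiltedLaw_iff measurable_id']
    exact h.integrable_M_rpow_mul_log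
  · rw [h.integral_tiltedLaw measurable_id']
    exact h.integral_M_rpow_mul_log_pos
  · rintro ⟨d, hd, hd'⟩
    exact hna ⟨d, hd, h.ae_of_ae_tiltedLaw hd'⟩

/-- A Tauberian step: the limits of the increments of `a` determine the limit of the function `r`
sandwiched between rescaled increments. -/
theorem tendsto_of_tendsto_increment {a r : ℝ → ℝ} {b c : ℝ} (hb : 0 < b)
    (hle : ∀ t x, 0 < x → (1 - rexp (-(b * x))) * r t ≤ a t - a (t - x))
    (hge : ∀ t x, 0 < x → a (t + x) - a t ≤ (rexp (b * x) - 1) * r t)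
    (ha : ∀ x, Tendsto (fun t => a t - a (t - x)) atTop (nhds (x * c))) :
    Tendsto r atTop (nhds (c / b)) := by
  have hpos : ∀ {φ : ℝ → ℝ} {φ' : ℝ}, HasDerivAt φ φ' 0 → φ 0 = 0 → 0 < φ' →
      ∃ x, 0 < x ∧ 0 < φ x := by
    intro φ φ' hφ h0 hφ'
    have h1 := hφ.tendsto_slope_zero_right.eventually_const_lt hφ'
    obtain ⟨x, hx, hx0⟩ := (h1.and self_mem_nhdsWithin).exists
    refine ⟨x, hx0, ?_⟩
    rw [zero_add, h0, sub_zero, smul_eq_mul] at hx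
    exact pos_of_mul_pos_right hx (inv_nonneg.2 (le_of_lt hx0))
  refine tendsto_order.2 ⟨fun z hz => ?_, fun z hz => ?_⟩
  · rw [lt_div_iff₀ hb] at hz
    have hd : HasDerivAt (fun x => x * c - z * (rexp (b * x) - 1))
        (1 * c - z * (rexp (b * 0) * (b * 1))) 0 :=
      ((hasDerivAt_id (0 : ℝ)).mul_const c).sub
        ((((hasDerivAt_id (0 : ℝ)).const_mul b).exp.sub_const 1).const_mul z)
    obtain ⟨x, hx0, hx⟩ := hpos hd (by simp) (by simp; linarith)
    have h1 : Tendsto (fun t => a (t + x) - a t) atTop (nhds (x * c)) := by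
      refine ((ha x).comp (tendsto_atTop_add_const_right atTop x tendsto_id)).congr fun t => ?_
      simp
    filter_upwards [h1.eventually_const_lt (sub_pos.1 hx)] with t ht
    have h2 : 0 < rexp (b * x) - 1 := sub_pos.2 (one_lt_exp_iff.2 (mul_pos hb hx0))
    have h3 := ht.trans_le (hge t x hx0)
    rw [mul_comm] at h3
    exact lt_of_mul_lt_mul_left h3 h2.le
  · rw [gt_iff_lt, div_lt_iff₀ hb] at hz
    have hd : HasDerivAt (fun x => z * (1 - rexp (-(b * x))) - x * c)
        (z * -(rexp (-(b * 0)) * -(b * 1)) - 1 * c) 0 :=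
      ((((hasDerivAt_id (0 : ℝ)).const_mul b).neg.exp.const_sub 1).const_mul z).sub
        ((hasDerivAt_id (0 : ℝ)).mul_const c)
    obtain ⟨x, hx0, hx⟩ := hpos hd (by simp) (by simp; linarith)
    filter_upwards [(ha x).eventually_lt_const (sub_pos.1 hx)] with t ht
    have h2 : 0 < 1 - rexp (-(b * x)) :=
      sub_pos.2 (exp_lt_one_iff.2 (neg_lt_zero.2 (mul_pos hb hx0)))
    have h3 := (hle t x hx0).trans_lt ht
    rw [mul_comm z] at h3
    exact lt_of_mul_lt_mul_left h3 h2.le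

theorem exists_tendsto_tail (h : IsPerpetuity μ M Q Y β)
    (hna : ¬ ∃ d : ℝ, 0 < d ∧ ∀ᵐ ω ∂μ, ∃ k : ℤ, Real.log (M ω) = k * d) :
    ∃ C, Tendsto (fun u : ℝ => u ^ β * μ.real {ω | u < Y ω}) atTop (nhds C) := by
  have hY := h.measurable_Y
  have hβ := h.β_pos
  obtain ⟨c, hc⟩ := h.exists_tendsto_truncMoment_sub hna
  have h1 := tendsto_of_tendsto_increment
    (r := fun t => rexp t ^ β * μ.real {ω | rexp t < Y ω}) hβ (fun t x hx => ?_)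
    (fun t x hx => ?_) hc
  · refine ⟨c / β, (h1.comp tendsto_log_atTop).congr' ?_⟩
    filter_upwards [eventually_gt_atTop 0] with u hu
    simp only [Function.comp_apply, exp_log hu]
  · refine le_trans (le_of_eq ?_) (mul_measureReal_le_truncMoment_sub hY hβ (exp_pos (t - x)).le
      (exp_le_exp.2 (by linarith)))
    rw [← mul_assoc, ← exp_mul, ← exp_mul, sub_mul, ← exp_add, one_mul]
    ring_nf
  · refine (truncMoment_sub_le_mul_measureReal hY hβ (exp_pos t).le
      (exp_le_exp.2 (by linarith))).trans (le_of_eq ?_)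
    rw [← mul_assoc]
    congr 1
    rw [← exp_mul, ← exp_mul, sub_mul, ← exp_add, one_mul]
    ring_nf

theorem exists_abs_integral_posPow_sub_le (h : IsPerpetuity μ M Q Y β) {p ε : ℝ} (hε : 0 < ε)
    (hε1 : ε ≤ 1) (hεp : ε ≤ p) (hp : p ≤ β) :
    ∃ C, 0 < C ∧ ∀ y, Integrable (fun ω => posPow p (Q ω + M ω * y)) μ ∧
      |∫ ω, posPow p (Q ω + M ω * y) ∂μ - (∫ ω, M ω ^ p ∂μ) * posPow p y|
        ≤ C * (1 + posPow (p - ε) y) := by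
  have hM := h.measurable_M
  have hQ := h.measurable_Q
  obtain ⟨C, hC0, hC⟩ := exists_abs_posPow_add_sub_le hε hε1 hεp
  have hiM := h.integrable_M_rpow (hε.le.trans hεp) hp
  have hiQ := h.integrable_Q_rpow (hε.le.trans hεp) hp
  have hiQM := h.integrable_Q_rpow_mul_M_rpow hε.le hεp hp
  set a := ∫ ω, |Q ω| ^ p ∂μ with ha
  set b := ∫ ω, |Q ω| ^ ε * M ω ^ (p - ε) ∂μ with hb
  have ha0 : 0 ≤ a := integral_nonneg fun ω => by positivity
  have hb0 : 0 ≤ b := integral_nonneg fun ω => by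
    have := h.M_pos ω
    positivity
  refine ⟨C * (a + b + 1), by positivity, fun y => ?_⟩
  have hy := posPow_nonneg (p - ε) y
  have hiD : Integrable (fun ω => C * (|Q ω| ^ p +
      |Q ω| ^ ε * M ω ^ (p - ε) * posPow (p - ε) y)) μ :=
    (hiQ.add (hiQM.mul_const _)).const_mul C
  have hD : ∀ ω, |posPow p (Q ω + M ω * y) - M ω ^ p * posPow p y|
      ≤ C * (|Q ω| ^ p + |Q ω| ^ ε * M ω ^ (p - ε) * posPow (p - ε) y) := fun ω => by
    have h1 := hC (M ω * y) (Q ω)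
    rw [posPow_mul (h.M_pos ω).le, posPow_mul (h.M_pos ω).le, ← mul_assoc,
      add_comm (M ω * y)] at h1
    exact h1
  have hid : Integrable (fun ω => posPow p (Q ω + M ω * y) - M ω ^ p * posPow p y) μ :=
    hiD.mono' (Measurable.aestronglyMeasurable (by fun_prop)) (ae_of_all _ hD)
  have hi : Integrable (fun ω => posPow p (Q ω + M ω * y)) μ := by
    refine (hid.add (hiM.mul_const (posPow p y))).congr (ae_of_all _ fun ω => ?_)
    simp
  refine ⟨hi, ?_⟩
  rw [← integral_mul_const, ← integral_sub hi (hiM.mul_const _)]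
  refine abs_integral_le_integral_abs.trans ((integral_mono hid.abs hiD hD).trans ?_)
  rw [integral_const_mul, integral_add hiQ (hiQM.mul_const _), integral_mul_const]
  nlinarith [mul_nonneg hC0.le (mul_nonneg ha0 hy), mul_nonneg hC0.le hb0,
    mul_nonneg hC0.le hy]

/-- A nonnegative function dominated by `y₊ ^ β` that is subharmonic for the chain `y ↦ Q + M * y`,
and strictly so at large values. -/
theorem exists_subharmonic (h : IsPerpetuity μ M Q Y β) :
    ∃ (W : ℝ → ℝ) (y₀ : ℝ), Measurable W ∧ (∀ y, 0 ≤ W y) ∧ (∀ y, W y ≤ posPow β y) ∧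
      (∀ y, Integrable (fun ω => W (Q ω + M ω * y)) μ) ∧
      (∀ y, W y ≤ ∫ ω, W (Q ω + M ω * y) ∂μ) ∧
      ∀ y, y₀ < y → W y < ∫ ω, W (Q ω + M ω * y) ∂μ := by
  have hM := h.measurable_M
  have hQ := h.measurable_Q
  have hβ := h.β_pos
  obtain ⟨ε, hε0, hε1, hεβ, -, -⟩ := h.exists_integrable_posPow
  set p := β - ε with hp
  have hp0 : 0 < p := by linarith
  obtain ⟨C₁, hC₁, hβC⟩ := h.exists_abs_integral_posPow_sub_le hε0 hε1.le (by linarith) le_rfl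
  obtain ⟨C₂, hC₂, hpC⟩ := h.exists_abs_integral_posPow_sub_le (p := p) hε0 hε1.le (by linarith)
    (by linarith)
  have hδ : 0 < 1 - ∫ ω, M ω ^ p ∂μ := by
    linarith [h.integral_M_rpow_lt_one hp0 (by linarith)]
  set δ := 1 - ∫ ω, M ω ^ p ∂μ with hδdef
  set κ := 1 + (2 * C₁ + 2 * C₂) / δ with hκ
  have hκ1 : 1 < κ := by rw [hκ]; linarith [show 0 < (2 * C₁ + 2 * C₂) / δ by positivity]
  have hκδ : 2 * C₁ + 2 * C₂ < κ * δ := by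
    rw [hκ, add_mul, div_mul_cancel₀ _ hδ.ne']; linarith
  set y₀ := κ ^ (1 / ε) with hy₀
  have hy₀1 : 1 < y₀ := one_lt_rpow hκ1 (by positivity)
  have hy₀ε : y₀ ^ ε = κ := by
    rw [hy₀, ← rpow_mul (by linarith), one_div_mul_cancel hε0.ne', rpow_one]
  set W : ℝ → ℝ := fun y => max (posPow β y - κ * posPow p y) 0 with hW
  have hWm : Measurable W := by rw [hW]; fun_prop
  have hW0 : ∀ y, 0 ≤ W y := fun y => le_max_right _ _
  have hWβ : ∀ y, W y ≤ posPow β y := fun y =>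
    max_le (by linarith [mul_nonneg (by linarith : 0 ≤ κ) (posPow_nonneg p y)]) (posPow_nonneg _ _)
  have hWi : ∀ y, Integrable (fun ω => W (Q ω + M ω * y)) μ := fun y => by
    refine (hβC y).1.mono' (hWm.comp (by fun_prop)).aestronglyMeasurable (ae_of_all _ fun ω => ?_)
    rw [norm_of_nonneg (hW0 _)]
    exact hWβ _
  have hlow : ∀ y, y ≤ y₀ → W y = 0 := fun y hy => by
    rcases le_or_gt y 0 with h0 | h0
    · simp [hW, posPow_of_nonpos h0 hβ.ne', posPow_of_nonpos h0 hp0.ne']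
    · refine max_eq_right (sub_nonpos.2 ?_)
      rw [posPow_of_nonneg h0.le, posPow_of_nonneg h0.le, show β = ε + p by rw [hp]; ring,
        rpow_add h0]
      have := rpow_le_rpow h0.le hy hε0.le
      rw [hy₀ε] at this
      gcongr
  have hhigh : ∀ y, y₀ < y → W y < ∫ ω, W (Q ω + M ω * y) ∂μ := fun y hy => by
    have hy1 : 1 < y := hy₀1.trans hy
    have h0 : 0 < y := by linarith
    have hyε : κ < y ^ ε := by
      rw [← hy₀ε]; exact rpow_lt_rpow (by linarith) hy hε0
    have hyp : 1 ≤ y ^ p := one_le_rpow hy1.le hp0.le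
    have hypε : 1 ≤ y ^ (p - ε) := one_le_rpow hy1.le (by linarith)
    have h1 := (abs_le.1 (hβC y).2).1
    have h2 := (abs_le.1 (hpC y).2).2
    rw [h.integral_M, one_mul, posPow_of_nonneg h0.le, posPow_of_nonneg h0.le] at h1
    rw [posPow_of_nonneg h0.le, posPow_of_nonneg h0.le] at h2
    have h3 : ∫ ω, posPow β (Q ω + M ω * y) ∂μ - κ * ∫ ω, posPow p (Q ω + M ω * y) ∂μ
        ≤ ∫ ω, W (Q ω + M ω * y) ∂μ := by
      rw [← integral_const_mul, ← integral_sub (hβC y).1 ((hpC y).1.const_mul κ)]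
      exact integral_mono ((hβC y).1.sub ((hpC y).1.const_mul κ)) (hWi y) fun ω => le_max_left _ _
    have h4 : κ * y ^ (p - ε) ≤ y ^ p := by
      calc κ * y ^ (p - ε) ≤ y ^ ε * y ^ (p - ε) := by gcongr
        _ = y ^ p := by rw [← rpow_add h0]; congr 1; ring
    have h5 : W y = y ^ β - κ * y ^ p := by
      simp only [hW, posPow_of_nonneg h0.le]
      refine max_eq_left (sub_nonneg.2 ?_)
      rw [show β = ε + p by rw [hp]; ring, rpow_add h0]
      gcongr
    rw [h5]
    rw [← hp] at h1
    rw [show ∫ ω, M ω ^ p ∂μ = 1 - δ by rw [hδdef]; ring] at h2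
    have h6 : κ * ∫ ω, posPow p (Q ω + M ω * y) ∂μ
        ≤ κ * ((1 - δ) * y ^ p + C₂ * (1 + y ^ (p - ε))) := by
      apply mul_le_mul_of_nonneg_left _ (by linarith); linarith
    have h7 : κ * (C₂ * (1 + y ^ (p - ε))) ≤ 2 * C₂ * y ^ p := by
      calc κ * (C₂ * (1 + y ^ (p - ε))) ≤ κ * (C₂ * (2 * y ^ (p - ε))) := by
            gcongr; linarith
        _ = 2 * C₂ * (κ * y ^ (p - ε)) := by ring
        _ ≤ 2 * C₂ * y ^ p := by gcongr
    have h8 : C₁ * (1 + y ^ p) ≤ 2 * C₁ * y ^ p := by nlinarith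
    have h9 : (2 * C₁ + 2 * C₂) * y ^ p < κ * δ * y ^ p :=
      mul_lt_mul_of_pos_right hκδ (by linarith)
    nlinarith
  refine ⟨W, y₀, hWm, hW0, hWβ, hWi, fun y => ?_, hhigh⟩
  rcases le_or_gt y y₀ with hy | hy
  · rw [hlow y hy]
    exact integral_nonneg fun ω => hW0 _
  · exact (hhigh y hy).le

theorem integrable_indicator_mul_posPow (h : IsPerpetuity μ M Q Y β) (u : ℝ) :
    Integrable (fun ω => (Set.Iic u).indicator (fun _ => (1 : ℝ)) (Y ω) *
      posPow β (Q ω + M ω * Y ω)) μ := by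
  have hM := h.measurable_M
  have hQ := h.measurable_Q
  have hY := h.measurable_Y
  have hind : Measurable ((Set.Iic u).indicator (fun _ => (1 : ℝ))) :=
    measurable_const.indicator measurableSet_Iic
  obtain ⟨ε, hε0, hε1, hεβ, hY1, -⟩ := h.exists_integrable_posPow
  obtain ⟨D, hDi, hD⟩ := h.exists_integrable_bound hε0 hε1.le (by linarith) le_rfl hY1
  have hi : Integrable (fun ω => M ω ^ β * (posPow β u)) μ := h.integrable_M.mul_const _
  refine (hDi.add hi).mono'
    ((hind.comp hY).mul (by fun_prop)).aestronglyMeasurable (ae_of_all _ fun ω => ?_)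
  have h1 := hD ω
  have hD0 := (abs_nonneg _).trans h1
  have hm := rpow_nonneg (h.M_pos ω).le β
  by_cases hy : Y ω ≤ u
  · rw [Set.indicator_of_mem (show Y ω ∈ Set.Iic u from hy), one_mul,
      norm_of_nonneg (posPow_nonneg _ _)]
    have h2 := (abs_le.1 h1).2
    rw [posPow_mul (h.M_pos ω).le] at h2
    have h3 := mul_le_mul_of_nonneg_left (posPow_mono h.β_pos.le hy) hm
    simp only [Pi.add_apply]
    linarith
  · rw [Set.indicator_of_notMem (show Y ω ∉ Set.Iic u from hy), zero_mul, norm_zero]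
    exact add_nonneg hD0 (mul_nonneg hm (posPow_nonneg _ _))

/-- If `Y` is unbounded from above, then mass has to be carried upwards across every high level. -/
theorem exists_le_tail_add_integral (h : IsPerpetuity μ M Q Y β)
    (hunb : ∀ u : ℝ, 0 < μ {ω | u < Y ω}) :
    ∃ g, 0 < g ∧ ∀ᶠ u in atTop, g ≤ u ^ β * μ.real {ω | u < Y ω} +
      ∫ ω, {ω | Y ω ≤ u ∧ u < Q ω + M ω * Y ω}.indicator
        (fun ω => posPow β (Q ω + M ω * Y ω)) ω ∂μ := by
  have hM := h.measurable_M
  have hQ := h.measurable_Q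
  have hY := h.measurable_Y
  have hβ := h.β_pos
  obtain ⟨W, y₀, hWm, hW0, hWβ, hWi, hWle, hWlt⟩ := h.exists_subharmonic
  set G : ℝ → ℝ := fun y => ∫ ω, W (Q ω + M ω * y) ∂μ - W y with hG
  have hG0 : ∀ y, 0 ≤ G y := fun y => sub_nonneg.2 (hWle y)
  set I : ℝ → ℝ → ℝ := fun u => (Set.Iic u).indicator (fun _ => (1 : ℝ)) with hI
  have hIm : ∀ u, Measurable (I u) := fun u => measurable_const.indicator measurableSet_Iic
  have hI0 : ∀ u y, 0 ≤ I u y := fun u y => Set.indicator_nonneg (fun _ _ => zero_le_one) y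
  have hiZ : ∀ u, Integrable (fun ω => I u (Y ω) * W (Q ω + M ω * Y ω)) μ := fun u => by
    refine (h.integrable_indicator_mul_posPow u).mono'
      (((hIm u).comp hY).mul (hWm.comp (by fun_prop))).aestronglyMeasurable
      (ae_of_all _ fun ω => ?_)
    rw [norm_of_nonneg (mul_nonneg (hI0 _ _) (hW0 _))]
    exact mul_le_mul_of_nonneg_left (hWβ _) (hI0 _ _)
  have hiY : ∀ u, Integrable (fun ω => I u (Y ω) * W (Y ω)) μ := fun u => by
    refine Integrable.of_bound (((hIm u).comp hY).mul (hWm.comp hY)).aestronglyMeasurable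
      (posPow β u) (ae_of_all _ fun ω => ?_)
    rw [norm_of_nonneg (mul_nonneg (hI0 _ _) (hW0 _))]
    by_cases hy : Y ω ≤ u
    · simp only [hI, Set.indicator_of_mem (show Y ω ∈ Set.Iic u from hy), one_mul]
      exact (hWβ _).trans (posPow_mono hβ.le hy)
    · simp only [hI, Set.indicator_of_notMem (show Y ω ∉ Set.Iic u from hy), zero_mul]
      exact posPow_nonneg _ _
  have hfub : ∀ u, Integrable (fun ω => I u (Y ω) * G (Y ω)) μ ∧
      ∫ ω, (I u (Y ω) * W (Q ω + M ω * Y ω) - I u (Y ω) * W (Y ω)) ∂μ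
        = ∫ ω, I u (Y ω) * G (Y ω) ∂μ := fun u => by
    have hgm : Measurable (Function.uncurry fun (y : ℝ) (z : ℝ × ℝ) =>
        I u y * W (z.2 + z.1 * y) - I u y * W y) := by
      unfold Function.uncurry
      exact (((hIm u).comp measurable_fst).mul (hWm.comp (by fun_prop))).sub
        (((hIm u).comp measurable_fst).mul (hWm.comp measurable_fst))
    have h1 := h.integral_eq_integral_integral_symm hgm ((hiZ u).sub (hiY u))
    have h2 : ∀ y, ∫ ω, (I u y * W (Q ω + M ω * y) - I u y * W y) ∂μ = I u y * G y := fun y => by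
      rw [integral_sub ((hWi y).const_mul _) (integrable_const _), integral_const_mul]
      simp [hG, mul_sub]
    simp_rw [h2] at h1
    exact h1
  have hexists : ∃ n : ℕ, 0 < μ {ω | y₀ < Y ω ∧ Y ω ≤ n} := by
    refine exists_measure_pos_of_not_measure_iUnion_null ?_
    have : (⋃ n : ℕ, {ω | y₀ < Y ω ∧ Y ω ≤ n}) = {ω | y₀ < Y ω} := by
      ext ω
      simp only [Set.mem_iUnion, Set.mem_ofPred_eq]
      exact ⟨fun ⟨n, hn⟩ => hn.1, fun hω => (exists_nat_ge (Y ω)).imp fun n hn => ⟨hω, hn⟩⟩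
    rw [this]
    exact (hunb y₀).ne'
  obtain ⟨n, hn⟩ := hexists
  refine ⟨∫ ω, I n (Y ω) * G (Y ω) ∂μ, ?_, ?_⟩
  · rw [integral_pos_iff_support_of_nonneg (fun ω => mul_nonneg (hI0 _ _) (hG0 _)) (hfub n).1]
    refine hn.trans_le (measure_mono fun ω hω => ?_)
    refine (mul_pos ?_ (sub_pos.2 (hWlt _ hω.1))).ne'
    simp only [hI, Set.indicator_of_mem (show Y ω ∈ Set.Iic (n : ℝ) from hω.2), zero_lt_one]
  filter_upwards [eventually_ge_atTop (n : ℝ), eventually_ge_atTop 0] with u hu hu0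
  set S : Set Ω := {ω | Y ω ≤ u ∧ u < Q ω + M ω * Y ω} with hS
  have hSm : MeasurableSet S := (measurableSet_le hY measurable_const).inter
    (measurableSet_lt measurable_const (hQ.add (hM.mul hY)))
  have hTm : MeasurableSet {ω | u < Y ω} := measurableSet_lt measurable_const hY
  have hmono : ∫ ω, I n (Y ω) * G (Y ω) ∂μ ≤ ∫ ω, I u (Y ω) * G (Y ω) ∂μ := by
    refine integral_mono (hfub n).1 (hfub u).1 fun ω => mul_le_mul_of_nonneg_right ?_ (hG0 _)
    exact Set.indicator_le_indicator_of_subset (Set.Iic_subset_Iic.2 hu) (fun _ => zero_le_one) _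
  have hiS : Integrable (fun ω => S.indicator (fun ω => posPow β (Q ω + M ω * Y ω)) ω) μ := by
    refine (h.integrable_indicator_mul_posPow u).mono'
      (Measurable.indicator (by fun_prop) hSm).aestronglyMeasurable (ae_of_all _ fun ω => ?_)
    by_cases hω : ω ∈ S
    · rw [Set.indicator_of_mem hω, Set.indicator_of_mem (show Y ω ∈ Set.Iic u from hω.1), one_mul,
        norm_of_nonneg (posPow_nonneg _ _)]
    · rw [Set.indicator_of_notMem hω, norm_zero]
      exact mul_nonneg (hI0 _ _) (posPow_nonneg _ _)
  have hwi : ∀ X : Ω → ℝ, Measurable X → Integrable (fun ω => W (min (X ω) u)) μ :=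
    fun X hX => by
    refine Integrable.of_bound (hWm.comp (by fun_prop)).aestronglyMeasurable (posPow β u)
      (ae_of_all _ fun ω => ?_)
    rw [norm_of_nonneg (hW0 _)]
    exact (hWβ _).trans (posPow_mono hβ.le (min_le_right _ _))
  have heq : ∫ ω, (W (min (Q ω + M ω * Y ω) u) - W (min (Y ω) u)) ∂μ = 0 := by
    rw [integral_sub (hwi (fun ω => Q ω + M ω * Y ω) (by fun_prop)) (hwi _ hY),
      h.integral_comp_eq (φ := fun y => W (min y u))
        (hWm.comp (measurable_id.min measurable_const)), sub_self]
  have hi1 := (hiZ u).sub (hiY u)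
  have hi2 : Integrable (fun ω => u ^ β * {ω | u < Y ω}.indicator (1 : Ω → ℝ) ω) μ :=
    ((integrable_const _).indicator hTm).const_mul _
  have hle := integral_mono (hi1.sub (hi2.add hiS))
    ((hwi _ (by fun_prop : Measurable fun ω => Q ω + M ω * Y ω)).sub (hwi _ hY)) fun ω => ?_
  · have h1 := integral_sub hi1 (hi2.add hiS)
    have h2 := integral_add hi2 hiS
    rw [integral_const_mul, integral_indicator_one hTm] at h2
    have h3 := (hfub u).2
    simp only [Pi.add_apply, Pi.sub_apply] at h1 h2 h3 hle
    rw [h1, h2, h3, heq] at hle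
    linarith
  · simp only [Pi.add_apply, Pi.sub_apply]
    by_cases hy : Y ω ≤ u
    · simp only [hI, Set.indicator_of_mem (show Y ω ∈ Set.Iic u from hy), one_mul,
        Set.indicator_of_notMem (show ω ∉ {ω | u < Y ω} from not_lt.2 hy), mul_zero, zero_add,
        min_eq_left hy]
      by_cases hz : u < Q ω + M ω * Y ω
      · rw [Set.indicator_of_mem (show ω ∈ S from ⟨hy, hz⟩), min_eq_right hz.le]
        linarith [hWβ (Q ω + M ω * Y ω), hW0 u]
      · rw [Set.indicator_of_notMem (show ω ∉ S from fun hω => hz hω.2), min_eq_left (not_lt.1 hz)]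
        linarith
    · have hy' := not_le.1 hy
      simp only [hI, Set.indicator_of_notMem (show Y ω ∉ Set.Iic u from hy), zero_mul,
        Set.indicator_of_mem (show ω ∈ {ω | u < Y ω} from hy'), Pi.one_apply, mul_one,
        min_eq_right hy'.le, Set.indicator_of_notMem (show ω ∉ S from fun hω => hy hω.1)]
      have h1 := hWβ u
      rw [posPow_of_nonneg hu0] at h1
      linarith [hW0 (min (Q ω + M ω * Y ω) u)]

/-- The part of the truncated moment carried by a band of logarithmic width `log (w / v)`. -/
theorem exists_integral_band_le (h : IsPerpetuity μ M Q Y β) :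
    ∃ K B, 0 ≤ K ∧ 0 ≤ B ∧ ∀ v w, 0 < v → v ≤ w →
      ∫ ω, (Set.Ioc v w).indicator (posPow β) (Y ω) ∂μ ≤ K * Real.log (w / v) + B := by
  have hY := h.measurable_Y
  have hβ := h.β_pos
  obtain ⟨K, hK0, hK⟩ := h.exists_truncMoment_exp_sub_le
  obtain ⟨B, hB0, hB⟩ := h.exists_tail_le
  refine ⟨K, B, hK0, hB0, fun v w hv hvw => ?_⟩
  have hw := hv.trans_le hvw
  have h1 := hK (Real.log v) (Real.log w) (log_le_log hv hvw)
  rw [exp_log hv, exp_log hw] at h1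
  have hm : MeasurableSet {ω | v < Y ω} := measurableSet_lt measurable_const hY
  have hiv := integrable_min_posPow (μ := μ) hY β (rpow_nonneg hv.le β)
  have hiw := integrable_min_posPow (μ := μ) hY β (rpow_nonneg hw.le β)
  have hii : Integrable (fun ω => v ^ β * {ω | v < Y ω}.indicator (1 : Ω → ℝ) ω) μ :=
    ((integrable_const _).indicator hm).const_mul _
  have hid : Integrable (fun ω => min (posPow β (Y ω)) (w ^ β) - min (posPow β (Y ω)) (v ^ β)) μ :=
    hiw.sub hiv
  have h2 : ∫ ω, (Set.Ioc v w).indicator (posPow β) (Y ω) ∂μ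
      ≤ ∫ ω, ((min (posPow β (Y ω)) (w ^ β) - min (posPow β (Y ω)) (v ^ β))
        + v ^ β * {ω | v < Y ω}.indicator (1 : Ω → ℝ) ω) ∂μ := by
    refine integral_mono_of_nonneg
      (ae_of_all _ fun ω => Set.indicator_nonneg (fun _ _ => posPow_nonneg _ _) _)
      (hid.add hii) (ae_of_all _ fun ω => ?_)
    by_cases hv' : v < Y ω
    · have h3 := (lt_posPow_iff hβ hv.le).2 hv'
      simp only [Set.indicator_of_mem (show ω ∈ {ω | v < Y ω} from hv'), Pi.one_apply, mul_one,
        min_eq_right h3.le, sub_add_cancel]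
      by_cases hw' : Y ω ≤ w
      · rw [Set.indicator_of_mem (show Y ω ∈ Set.Ioc v w from ⟨hv', hw'⟩)]
        refine le_min le_rfl ?_
        rw [posPow_of_nonneg (hv.trans hv').le]
        exact rpow_le_rpow (hv.trans hv').le hw' hβ.le
      · rw [Set.indicator_of_notMem (show Y ω ∉ Set.Ioc v w from fun hy => hw' hy.2)]
        exact le_min (posPow_nonneg _ _) (rpow_nonneg hw.le β)
    · simp only [Set.indicator_of_notMem (show Y ω ∉ Set.Ioc v w from fun hy => hv' hy.1),
        Set.indicator_of_notMem (show ω ∉ {ω | v < Y ω} from hv'), mul_zero, add_zero, sub_nonneg]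
      exact min_le_min_left _ (rpow_le_rpow hv.le hvw hβ.le)
  rw [integral_add hid hii, integral_sub hiw hiv, integral_const_mul,
    integral_indicator_one hm] at h2
  rw [log_div hw.ne' hv.ne']
  have h3 := hB v hv
  simp only [truncMoment] at h1
  linarith

/-- Jumps of `M * Y` across the level `u / 2` from below `u / (2 * τ)` require `M` to be large. -/
theorem exists_integral_low_le (h : IsPerpetuity μ M Q Y β) :
    ∃ R : Ω → ℝ, Integrable R μ ∧ ∀ τ u, 1 ≤ τ → 0 < u →
      ∫ ω, {ω | Y ω ≤ u / (2 * τ) ∧ u / 2 < M ω * Y ω}.indicator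
        (fun ω => posPow β (M ω * Y ω)) ω ∂μ ≤ ∫ ω, {ω | τ < M ω}.indicator R ω ∂μ := by
  have hM := h.measurable_M
  have hQ := h.measurable_Q
  have hY := h.measurable_Y
  have hβ := h.β_pos
  obtain ⟨K, B, hK0, hB0, hKB⟩ := h.exists_integral_band_le
  set R : Ω → ℝ := fun ω => M ω ^ β * (K * max (Real.log (M ω)) 0 + B) with hR
  have hR0 : ∀ ω, 0 ≤ R ω := fun ω => mul_nonneg (rpow_nonneg (h.M_pos ω).le β)
    (add_nonneg (mul_nonneg hK0 (le_max_right _ _)) hB0)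
  have hRi : Integrable R μ := by
    refine ((h.integrable_log.const_mul K).add (h.integrable_M.mul_const B)).congr
      (ae_of_all _ fun ω => ?_)
    simp only [hR, Pi.add_apply]
    ring
  refine ⟨R, hRi, fun τ u hτ hu => ?_⟩
  have hτ0 : 0 < τ := by linarith
  set N : Set (ℝ × ℝ × ℝ) := {q | q.1 ≤ u / (2 * τ) ∧ u / 2 < q.2.1 * q.1} with hN
  have hNm : MeasurableSet N := (measurableSet_le measurable_fst measurable_const).inter
    (measurableSet_lt measurable_const
      (by fun_prop : Measurable fun q : ℝ × ℝ × ℝ => q.2.1 * q.1))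
  set g : ℝ → ℝ × ℝ → ℝ := fun y z =>
    N.indicator (fun q => posPow β (q.2.1 * q.1)) (y, z) with hg
  have hgm : Measurable (Function.uncurry g) :=
    Measurable.indicator (by fun_prop : Measurable fun q : ℝ × ℝ × ℝ => posPow β (q.2.1 * q.1)) hNm
  have hg0 : ∀ y z, 0 ≤ g y z := fun y z => Set.indicator_nonneg (fun _ _ => posPow_nonneg _ _) _
  have hgi : Integrable (fun ω => g (Y ω) (M ω, Q ω)) μ := by
    refine (h.integrable_M.mul_const (posPow β (u / (2 * τ)))).mono'
      (hgm.comp (hY.prodMk (hM.prodMk hQ))).aestronglyMeasurable (ae_of_all _ fun ω => ?_)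
    have hm := rpow_nonneg (h.M_pos ω).le β
    rw [norm_of_nonneg (hg0 _ _)]
    by_cases hω : (Y ω, M ω, Q ω) ∈ N
    · simp only [hg, Set.indicator_of_mem hω, posPow_mul (h.M_pos ω).le]
      exact mul_le_mul_of_nonneg_left (posPow_mono hβ.le hω.1) hm
    · simp only [hg, Set.indicator_of_notMem hω]
      exact mul_nonneg hm (posPow_nonneg _ _)
  refine (h.integral_eq_integral_integral hgm hgi).le.trans ?_
  refine integral_mono_of_nonneg (ae_of_all _ fun ω => integral_nonneg fun ω' => hg0 _ _)
    (hRi.indicator (measurableSet_lt measurable_const hM)) (ae_of_all _ fun ω => ?_)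
  have hm := h.M_pos ω
  have hmβ := rpow_nonneg hm.le β
  by_cases hτm : τ < M ω
  · simp only [Set.indicator_of_mem (show ω ∈ {ω | τ < M ω} from hτm)]
    have hvw : u / (2 * M ω) ≤ u / (2 * τ) := by gcongr
    have h1 := hKB (u / (2 * M ω)) (u / (2 * τ)) (by positivity) hvw
    have h2 : Real.log (u / (2 * τ) / (u / (2 * M ω))) ≤ max (Real.log (M ω)) 0 := by
      refine le_max_of_le_left ?_
      rw [show u / (2 * τ) / (u / (2 * M ω)) = M ω / τ by field_simp]
      exact log_le_log (by positivity) (div_le_self hm.le hτ)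
    calc ∫ ω', g (Y ω') (M ω, Q ω) ∂μ
        = ∫ ω', M ω ^ β *
            (Set.Ioc (u / (2 * M ω)) (u / (2 * τ))).indicator (posPow β) (Y ω') ∂μ := by
          refine integral_congr_ae (ae_of_all _ fun ω' => ?_)
          have hiff : (Y ω', M ω, Q ω) ∈ N ↔ Y ω' ∈ Set.Ioc (u / (2 * M ω)) (u / (2 * τ)) := by
            simp only [hN, Set.mem_ofPred_eq, Set.mem_Ioc]
            have hlt : u / 2 < M ω * Y ω' ↔ u / (2 * M ω) < Y ω' := by
              rw [div_lt_iff₀ (by positivity : (0 : ℝ) < 2 * M ω), div_lt_iff₀ zero_lt_two,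
                show M ω * Y ω' * 2 = Y ω' * (2 * M ω) by ring]
            rw [and_comm, hlt]
          by_cases hω : (Y ω', M ω, Q ω) ∈ N
          · simp only [hg, Set.indicator_of_mem hω, Set.indicator_of_mem (hiff.1 hω),
              posPow_mul hm.le]
          · simp only [hg, Set.indicator_of_notMem hω, Set.indicator_of_notMem (mt hiff.2 hω),
              mul_zero]
      _ = M ω ^ β * ∫ ω', (Set.Ioc (u / (2 * M ω)) (u / (2 * τ))).indicator (posPow β) (Y ω') ∂μ :=
          integral_const_mul _ _
      _ ≤ M ω ^ β * (K * Real.log (u / (2 * τ) / (u / (2 * M ω))) + B) := by gcongr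
      _ ≤ R ω := by simp only [hR]; gcongr
  · simp only [Set.indicator_of_notMem (show ω ∉ {ω | τ < M ω} from hτm)]
    refine (integral_eq_zero_of_ae (ae_of_all _ fun ω' => ?_)).le
    refine Set.indicator_of_notMem (fun hω => ?_) _
    have h1 : M ω * Y ω' ≤ τ * (u / (2 * τ)) := by
      rcases le_total (Y ω') 0 with hy | hy
      · exact (mul_nonpos_of_nonneg_of_nonpos hm.le hy).trans (by positivity)
      · exact mul_le_mul (not_lt.1 hτm) hω.1 hy hτ0.le
    rw [show τ * (u / (2 * τ)) = u / 2 by field_simp] at h1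
    exact absurd hω.2 (not_lt.2 h1)

theorem exists_integral_crossing_le (h : IsPerpetuity μ M Q Y β) :
    ∃ R : Ω → ℝ, Integrable R μ ∧ ∀ τ u, 1 ≤ τ → 0 < u →
      ∫ ω, {ω | Y ω ≤ u ∧ u < Q ω + M ω * Y ω}.indicator
        (fun ω => posPow β (Q ω + M ω * Y ω)) ω ∂μ
      ≤ 2 ^ β * (∫ ω, {ω | u / 2 < |Q ω|}.indicator (fun ω => |Q ω| ^ β) ω ∂μ
        + (u ^ β * μ.real {ω | u / (2 * τ) < Y ω} + ∫ ω, {ω | τ < M ω}.indicator R ω ∂μ)) := by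
  have hM := h.measurable_M
  have hQ := h.measurable_Q
  have hY := h.measurable_Y
  have hβ := h.β_pos
  obtain ⟨R, hRi, hR⟩ := h.exists_integral_low_le
  refine ⟨R, hRi, fun τ u hτ hu => ?_⟩
  have hτ0 : 0 < τ := by linarith
  set η := u / (2 * τ) with hη
  set L : Set Ω := {ω | Y ω ≤ η ∧ u / 2 < M ω * Y ω} with hL
  have hLm : MeasurableSet L := (measurableSet_le hY measurable_const).inter
    (measurableSet_lt measurable_const (hM.mul hY))
  have hQm : MeasurableSet {ω | u / 2 < |Q ω|} := measurableSet_lt measurable_const hQ.abs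
  have hTm : MeasurableSet {ω | η < Y ω} := measurableSet_lt measurable_const hY
  have hiL : Integrable (fun ω => L.indicator (fun ω => posPow β (M ω * Y ω)) ω) μ := by
    refine (h.integrable_M.mul_const (posPow β η)).mono'
      (Measurable.indicator (by fun_prop) hLm).aestronglyMeasurable (ae_of_all _ fun ω => ?_)
    have hm := rpow_nonneg (h.M_pos ω).le β
    by_cases hω : ω ∈ L
    · rw [Set.indicator_of_mem hω, norm_of_nonneg (posPow_nonneg _ _), posPow_mul (h.M_pos ω).le]
      exact mul_le_mul_of_nonneg_left (posPow_mono hβ.le hω.1) hm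
    · rw [Set.indicator_of_notMem hω, norm_zero]
      exact mul_nonneg hm (posPow_nonneg _ _)
  have hiQ := h.integrable_Q.indicator hQm
  have hIm : Measurable ((Set.Ioi η).indicator (fun _ : ℝ => (1 : ℝ))) :=
    measurable_const.indicator measurableSet_Ioi
  have hI : ∫ ω, (Set.Ioi η).indicator (fun _ => (1 : ℝ)) (Y ω) ∂μ = μ.real {ω | η < Y ω} := by
    rw [← integral_indicator_one hTm]
    rfl
  have hiI : Integrable (fun ω => M ω ^ β * (u ^ β * (Set.Ioi η).indicator (fun _ => (1 : ℝ))
      (Y ω))) μ := by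
    refine h.integrable_mul (f := fun z => z.1 ^ β)
      (g := fun y => u ^ β * (Set.Ioi η).indicator (fun _ => (1 : ℝ)) y) (by fun_prop)
      (hIm.const_mul _) h.integrable_M ?_
    have hi1 : Integrable (fun ω => u ^ β * {ω | η < Y ω}.indicator (fun _ => (1 : ℝ)) ω) μ :=
      ((integrable_const _).indicator hTm).const_mul _
    exact hi1
  have hvI : ∫ ω, M ω ^ β * (u ^ β * (Set.Ioi η).indicator (fun _ => (1 : ℝ)) (Y ω)) ∂μ
      = u ^ β * μ.real {ω | η < Y ω} := by
    rw [h.integral_mul (f := fun z => z.1 ^ β)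
      (g := fun y => u ^ β * (Set.Ioi η).indicator (fun _ => (1 : ℝ)) y) (by fun_prop)
      (hIm.const_mul _), h.integral_M, one_mul, integral_const_mul, hI]
  have hmain : ∫ ω, {ω | Y ω ≤ u ∧ u < Q ω + M ω * Y ω}.indicator
        (fun ω => posPow β (Q ω + M ω * Y ω)) ω ∂μ
      ≤ ∫ ω, 2 ^ β * ({ω | u / 2 < |Q ω|}.indicator (fun ω => |Q ω| ^ β) ω
        + (M ω ^ β * (u ^ β * (Set.Ioi η).indicator (fun _ => (1 : ℝ)) (Y ω))
          + L.indicator (fun ω => posPow β (M ω * Y ω)) ω)) ∂μ := by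
    refine integral_mono_of_nonneg
      (ae_of_all _ fun ω => Set.indicator_nonneg (fun _ _ => posPow_nonneg _ _) _)
      ((hiQ.add (hiI.add hiL)).const_mul _) (ae_of_all _ fun ω => ?_)
    have hm := h.M_pos ω
    have hmβ := rpow_nonneg hm.le β
    have hA : 0 ≤ {ω | u / 2 < |Q ω|}.indicator (fun ω => |Q ω| ^ β) ω :=
      Set.indicator_nonneg (fun _ _ => rpow_nonneg (abs_nonneg _) β) _
    have hB : 0 ≤ M ω ^ β * (u ^ β * (Set.Ioi η).indicator (fun _ => (1 : ℝ)) (Y ω)) :=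
      mul_nonneg hmβ (mul_nonneg (rpow_nonneg hu.le β)
        (Set.indicator_nonneg (fun _ _ => zero_le_one) _))
    have hC : 0 ≤ L.indicator (fun ω => posPow β (M ω * Y ω)) ω :=
      Set.indicator_nonneg (fun _ _ => posPow_nonneg _ _) _
    beta_reduce
    by_cases hω : Y ω ≤ u ∧ u < Q ω + M ω * Y ω
    swap
    · rw [Set.indicator_of_notMem (by exact hω)]
      positivity
    obtain ⟨hy, hz⟩ := hω
    rw [Set.indicator_of_mem (show ω ∈ {ω | Y ω ≤ u ∧ u < Q ω + M ω * Y ω} from ⟨hy, hz⟩)]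
    rcases le_total (M ω * Y ω) (|Q ω|) with hc | hc
    · have h1 : Q ω + M ω * Y ω ≤ 2 * |Q ω| := by linarith [le_abs_self (Q ω)]
      rw [Set.indicator_of_mem (show ω ∈ {ω | u / 2 < |Q ω|} by
        simp only [Set.mem_ofPred_eq]; linarith)]
      have h2 := posPow_mono hβ.le h1
      rw [posPow_mul zero_le_two, posPow_of_nonneg (abs_nonneg (Q ω))] at h2
      refine h2.trans (mul_le_mul_of_nonneg_left ?_ (by positivity))
      linarith
    · have h1 : Q ω + M ω * Y ω ≤ 2 * (M ω * Y ω) := by linarith [le_abs_self (Q ω)]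
      have h2 := posPow_mono hβ.le h1
      rw [posPow_mul zero_le_two] at h2
      refine h2.trans (mul_le_mul_of_nonneg_left ?_ (by positivity))
      rcases le_or_gt (Y ω) η with hyη | hyη
      · rw [Set.indicator_of_mem (s := L) ⟨hyη, by linarith⟩]
        linarith
      · rw [Set.indicator_of_mem (show Y ω ∈ Set.Ioi η from hyη), mul_one] at hB ⊢
        have h3 := posPow_mono hβ.le hy
        rw [posPow_of_nonneg hu.le] at h3
        have h4 := mul_le_mul_of_nonneg_left h3 hmβ
        rw [posPow_mul hm.le]
        linarith
  have hiIL : Integrable (fun ω =>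
      M ω ^ β * (u ^ β * (Set.Ioi η).indicator (fun _ => (1 : ℝ)) (Y ω))
      + L.indicator (fun ω => posPow β (M ω * Y ω)) ω) μ := hiI.add hiL
  refine hmain.trans ?_
  rw [integral_const_mul, integral_add hiQ hiIL, integral_add hiI hiL, hvI]
  have := hR τ u hτ hu
  gcongr

theorem exists_le_tail (h : IsPerpetuity μ M Q Y β) (hunb : ∀ u : ℝ, 0 < μ {ω | u < Y ω}) :
    ∃ c, 0 < c ∧ ∀ᶠ u : ℝ in atTop, c ≤ u ^ β * μ.real {ω | u < Y ω} := by
  have hM := h.measurable_M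
  have hQ := h.measurable_Q
  obtain ⟨g, hg0, hg⟩ := h.exists_le_tail_add_integral hunb
  obtain ⟨R, hRi, hR⟩ := h.exists_integral_crossing_le
  have h2β : (0 : ℝ) < 2 ^ β := by positivity
  have hε : 0 < g / 4 / 2 ^ β := by positivity
  obtain ⟨τ, hτR, hτ1⟩ := (((tendsto_integral_indicator_lt hRi hM).eventually_lt_const hε).and
    (eventually_ge_atTop 1)).exists
  have hτ0 : 0 < 2 * τ := by linarith
  have hq := ((tendsto_integral_indicator_lt h.integrable_Q
    (by fun_prop : Measurable fun ω => |Q ω|)).comp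
      (tendsto_id.atTop_div_const zero_lt_two)).eventually_lt_const hε
  have hall : ∀ᶠ u : ℝ in atTop,
      g / 2 ≤ (1 + 2 ^ β) * (u ^ β * μ.real {ω | u / (2 * τ) < Y ω}) := by
    filter_upwards [hg, hq, eventually_gt_atTop 0] with u h1 h2 hu
    have h3 := hR τ u hτ1 hu
    have h4 : u ^ β * μ.real {ω | u < Y ω} ≤ u ^ β * μ.real {ω | u / (2 * τ) < Y ω} := by
      refine mul_le_mul_of_nonneg_left (measureReal_mono fun ω hω => ?_) (rpow_nonneg hu.le β)
      exact lt_of_le_of_lt (div_le_self hu.le (by linarith)) hω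
    rw [lt_div_iff₀ h2β] at h2 hτR
    simp only [Function.comp_apply, id] at h2
    linarith
  refine ⟨g / 2 / ((1 + 2 ^ β) * (2 * τ) ^ β), by positivity, ?_⟩
  filter_upwards [(tendsto_id.atTop_mul_const hτ0).eventually hall, eventually_gt_atTop 0]
    with u h1 hu
  simp only [id] at h1
  rw [mul_div_cancel_right₀ _ hτ0.ne', mul_rpow hu.le hτ0.le] at h1
  rw [div_le_iff₀ (by positivity)]
  linarith

end IsPerpetuity

/-- Tail asymptotics of the solution of the distributional equation `Y =d Q + M * Y`:
(1) `limsup_{u→∞} u^β P(Y > u) < ∞`; (2) if `Y` is unbounded from above then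
`liminf_{u→∞} u^β P(Y > u) > 0`; (3) if moreover the law of `log M` is non-arithmetic and `Y`
is unbounded from above then `P(Y > u) ∼ C₊ u^{-β}` as `u → ∞` for some constant `C₊ > 0`. -/
theorem tail_asymptotics_distributional_equation
    {Ω : Type*} [MeasurableSpace Ω] (μ : Measure Ω) [IsProbabilityMeasure μ]
    (M Q Y : Ω → ℝ) (hMmeas : Measurable M) (hQmeas : Measurable Q) (hYmeas : Measurable Y)
    (hMpos : ∀ᵐ ω ∂μ, 0 < M ω)
    (hMne1 : 0 < μ {ω | M ω ≠ 1})
    (β : ℝ) (hβ : 0 < β)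
    (hMβint : Integrable (fun ω => M ω ^ β) μ)
    (hMβ : ∫ ω, M ω ^ β ∂μ = 1)
    (hMlog : Integrable (fun ω => M ω ^ β * max (Real.log (M ω)) 0) μ)
    (hQβ : Integrable (fun ω => |Q ω| ^ β) μ)
    (hindep : IndepFun Y (fun ω => (M ω, Q ω)) μ)
    (hlaw : Measure.map Y μ = Measure.map (fun ω => Q ω + M ω * Y ω) μ) :
    (IsBoundedUnder (· ≤ ·) atTop (fun u : ℝ => u ^ β * (μ {ω | Y ω > u}).toReal)) ∧
    ((∀ u : ℝ, 0 < μ {ω | Y ω > u}) →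
      ∃ c : ℝ, 0 < c ∧ ∀ᶠ u : ℝ in atTop,
        c ≤ u ^ β * (μ {ω | Y ω > u}).toReal) ∧
    ((¬ ∃ d : ℝ, 0 < d ∧ ∀ᵐ ω ∂μ, ∃ k : ℤ, Real.log (M ω) = k * d) →
      (∀ u : ℝ, 0 < μ {ω | Y ω > u}) →
      ∃ Cp : ℝ, 0 < Cp ∧
        Tendsto (fun u : ℝ => u ^ β * (μ {ω | Y ω > u}).toReal) atTop (nhds Cp)) := by
  have hM : M =ᵐ[μ] fun ω => if 0 < M ω then M ω else 1 := by
    filter_upwards [hMpos] with ω hω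
    rw [if_pos hω]
  set M' : Ω → ℝ := fun ω => if 0 < M ω then M ω else 1 with hM'
  have h : IsPerpetuity μ M' Q Y β :=
    { measurable_M := Measurable.ite (measurableSet_lt measurable_const hMmeas) hMmeas
        measurable_const
      measurable_Q := hQmeas
      measurable_Y := hYmeas
      M_pos := fun ω => by
        simp only [hM']
        split_ifs with hω
        exacts [hω, one_pos]
      M_ne_one := by
        refine hMne1.trans_le (measure_mono_ae ?_)
        filter_upwards [hM] with ω hω hne
        change M' ω ≠ 1
        rwa [← hω]
      β_pos := hβ
      integrable_M := hMβint.congr (hM.fun_comp fun x => x ^ β)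
      integral_M := (integral_congr_ae (hM.fun_comp fun x => x ^ β)).symm.trans hMβ
      integrable_log := hMlog.congr (hM.fun_comp fun x => x ^ β * max (Real.log x) 0)
      integrable_Q := hQβ
      indep := hindep.congr (ae_eq_refl Y) (by
        filter_upwards [hM] with ω hω
        rw [hω])
      map_eq := hlaw.trans (Measure.map_congr (by
        filter_upwards [hM] with ω hω
        rw [hω])) }
  refine ⟨?_, h.exists_le_tail, fun hna hunb => ?_⟩
  · obtain ⟨B, -, hB⟩ := h.exists_tail_le
    exact isBoundedUnder_of_eventually_le ((eventually_gt_atTop 0).mono hB)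
  · obtain ⟨C, hC⟩ := h.exists_tendsto_tail fun ⟨d, hd, hk⟩ => hna ⟨d, hd, by
      filter_upwards [hM, hk] with ω hω hkω
      rwa [hω]⟩
    obtain ⟨c, hc0, hc⟩ := h.exists_le_tail hunb
    exact ⟨C, hc0.trans_le (ge_of_tendsto hC hc), hC⟩
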